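/- arXiv:2212.05355 — 3 statements merged into one kernel-verified Lean document; each statement's English description precedes it below -/
import Mathlib

section
/- For a centered Gaussian random vector Y ~ N(0, Σ) in R^p with all diagonal entries Σ_ii > 0, any r ∈ R^p, and any δ ≥ 0, the probability that Y lies in the slab A_{r,δ} = {x : x ≤ r + δ·1 componentwise} \ {x : x ≤ r − δ·1 componentwise} is at most C · δ · sqrt(log(e·p) / min_i Σ_ii) for some absolute constant C > 0. -/
open MeasureTheory ProbabilityTheory Real
open scoped Classical

noncomputable def stdGaussian (ι : Type*) [Fintype ι] : Measure (ι → ℝ) :=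
  Measure.pi (fun _ => gaussianReal 0 1)

def slab {p : ℕ} (r : Fin p → ℝ) (δ : ℝ) : Set (Fin p → ℝ) :=
  {x | ∀ k, x k ≤ r k + δ} \ {x | ∀ k, x k ≤ r k - δ}

noncomputable def kdist {Ω : Type*} [MeasurableSpace Ω] (P : Measure Ω) {p : ℕ}
    (U V : Ω → Fin p → ℝ) : ℝ :=
  ⨆ r : Fin p → ℝ,
    |(P {ω | ∀ k, U ω k ≤ r k}).toReal - (P {ω | ∀ k, V ω k ≤ r k}).toReal|

def IsCenteredGaussianLaw {Ω : Type*} [MeasurableSpace Ω] (P : Measure Ω)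
    {ι : Type*} [Fintype ι] (Y : Ω → ι → ℝ) (S : Matrix ι ι ℝ) : Prop :=
  ∃ A : Matrix ι ι ℝ, S = A * A.transpose ∧
    Measure.map Y P = Measure.map (fun z => A.mulVec z) (stdGaussian ι)

noncomputable def covM {Ω : Type*} [MeasurableSpace Ω] (P : Measure Ω) {p : ℕ}
    (U V : Ω → Fin p → ℝ) : Matrix (Fin p) (Fin p) ℝ :=
  Matrix.of fun a b => ∫ ω, U ω a * V ω b ∂P

noncomputable def Spre {Ω : Type*} {n p : ℕ} (X : Fin n → Ω → Fin p → ℝ) (i : ℕ) :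
    Ω → Fin p → ℝ :=
  fun ω a => ∑ k ∈ Finset.univ.filter (fun k : Fin n => (k : ℕ) < i), X k ω a

noncomputable def Sblk {Ω : Type*} {n p : ℕ} (X : Fin n → Ω → Fin p → ℝ) (a b : ℕ) :
    Ω → Fin p → ℝ :=
  fun ω j => ∑ k ∈ Finset.univ.filter (fun k : Fin n => a ≤ (k : ℕ) ∧ (k : ℕ) ≤ b), X k ω j

def Gpast {Ω : Type*} [MeasurableSpace Ω] {n p : ℕ} (X : Fin n → Ω → Fin p → ℝ) (i : ℕ) :
    MeasurableSpace Ω :=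
  ⨆ k : Fin n, ⨆ _ : i ≤ (k : ℕ), MeasurableSpace.comap (X k) inferInstance

def CondACBound {Ω : Type*} [MeasurableSpace Ω] {n p : ℕ} (P : Measure Ω)
    (X : Fin n → Ω → Fin p → ℝ) (i : ℕ) (δ K : ℝ) : Prop :=
  ∀ r : Ω → Fin p → ℝ, Measurable[Gpast X i] r →
    ∀ᵐ ω ∂P,
      (P[Set.indicator {ω' | Spre X i ω' ∈ slab (r ω') δ} (fun _ => (1:ℝ)) | Gpast X i]) ω ≤ K

noncomputable abbrev gam (p : ℕ) : Measure (Fin p → ℝ) := Measure.pi (fun _ => gaussianReal 0 1)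

lemma law_dot {p : ℕ} (u : Fin p → ℝ) (hu : ∑ k, u k ^ 2 = 1) :
    (gam p).map (fun z => ∑ k, u k * z k) = gaussianReal 0 1 := by
  have hmeas : Measurable (fun z : Fin p → ℝ => ∑ k, u k * z k) :=
    Finset.measurable_sum _ fun k _ => (measurable_pi_apply k).const_mul _
  have : IsProbabilityMeasure ((gam p).map (fun z => ∑ k, u k * z k)) :=
    Measure.isProbabilityMeasure_map hmeas.aemeasurable
  apply Measure.ext_of_charFun
  ext t
  rw [charFun_gaussianReal, charFun_apply_real, integral_map hmeas.aemeasurable (by fun_prop)]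
  have h1 : ∀ z : Fin p → ℝ, Complex.exp (t * ((∑ k, u k * z k : ℝ) : ℂ) * Complex.I) =
      ∏ k, Complex.exp ((t * u k : ℝ) * (z k : ℂ) * Complex.I) := by
    intro z
    rw [← Complex.exp_sum]
    congr 1
    push_cast
    rw [Finset.mul_sum, Finset.sum_mul]
    refine Finset.sum_congr rfl fun k _ => by ring
  simp_rw [h1]
  rw [integral_fintype_prod_eq_prod
    (f := fun k (x : ℝ) => Complex.exp ((t * u k : ℝ) * (x : ℂ) * Complex.I))]
  have h2 : ∀ k, ∫ x, Complex.exp ((t * u k : ℝ) * (x : ℂ) * Complex.I) ∂(gaussianReal 0 1)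
      = Complex.exp (-(((t * u k : ℝ) : ℂ) ^ 2 / 2)) := by
    intro k
    rw [← charFun_apply_real, charFun_gaussianReal]
    simp
  simp_rw [h2]
  rw [← Complex.exp_sum]
  congr 1
  have : ∑ k, -(((t * u k : ℝ) : ℂ) ^ 2 / 2) = ((-(t^2/2) * ∑ k, u k ^ 2 : ℝ) : ℂ) := by
    push_cast
    rw [Finset.mul_sum]
    refine Finset.sum_congr rfl fun k _ => by ring
  rw [this, hu]
  simp

lemma law_conv (s : ℝ) : ((gaussianReal 0 1).prod (gaussianReal 0 1)).map
    (fun x : ℝ × ℝ => x.1 + s * x.2) = (gaussianReal 0 1).map (fun x => √(1 + s^2) * x) := by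
  have h1 : ((gaussianReal 0 1).prod (gaussianReal 0 1)).map (fun x : ℝ × ℝ => x.1 + s * x.2)
      = (gaussianReal 0 1) ∗ ((gaussianReal 0 1).map (fun x => s * x)) := by
    rw [Measure.conv]
    have h0 : (gaussianReal 0 1).prod ((gaussianReal 0 1).map (fun x => s * x)) =
        ((gaussianReal 0 1).prod (gaussianReal 0 1)).map (Prod.map id (fun x => s * x)) := by
      rw [← Measure.map_prod_map _ _ (by fun_prop) (by fun_prop), Measure.map_id]
    rw [h0, Measure.map_map (by fun_prop) (by fun_prop)]
    rfl
  rw [h1, gaussianReal_map_const_mul, gaussianReal_map_const_mul, gaussianReal_conv_gaussianReal]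
  congr 1
  · simp
  · ext
    simp
    rw [Real.sq_sqrt (by positivity)]

lemma law_sum (p : ℕ) (s : ℝ) : ((gam p).prod (gam p)).map
    (fun x : (Fin p → ℝ) × (Fin p → ℝ) => x.1 + s • x.2) =
      (gam p).map (fun x => √(1 + s^2) • x) := by
  have h := (measurePreserving_arrowProdEquivProdArrow ℝ ℝ (Fin p)
    (fun _ => gaussianReal 0 1) (fun _ => gaussianReal 0 1)).map_eq
  rw [← h, Measure.map_map (by fun_prop) (by fun_prop)]
  have h1 := Measure.pi_map_pi (μ := fun _ : Fin p => (gaussianReal 0 1).prod (gaussianReal 0 1))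
    (f := fun _ (x : ℝ × ℝ) => x.1 + s * x.2) (fun i => by fun_prop)
  have h2 := Measure.pi_map_pi (μ := fun _ : Fin p => gaussianReal 0 1)
    (f := fun _ (x : ℝ) => √(1 + s^2) * x) (fun i => by fun_prop)
  simp_rw [law_conv] at h1
  exact h1.trans h2.symm

noncomputable def PhiF (e m : ℝ) : ℝ := √(e^2 + m^2) + m

lemma PhiF_lip (e m m' : ℝ) (he : 0 < e) : |PhiF e m - PhiF e m'| ≤ 2 * |m - m'| := by
  have key : |√(e^2+m^2) - √(e^2+m'^2)| ≤ |m - m'| := by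
    have ha : |m| ≤ √(e^2+m^2) := Real.abs_le_sqrt (by nlinarith)
    have hb : |m'| ≤ √(e^2+m'^2) := Real.abs_le_sqrt (by nlinarith)
    have ha2 := Real.sq_sqrt (show 0 ≤ e^2+m^2 by positivity)
    have hb2 := Real.sq_sqrt (show 0 ≤ e^2+m'^2 by positivity)
    have ha0 : 0 < √(e^2+m^2) := by positivity
    have hb0 : 0 < √(e^2+m'^2) := by positivity
    set a := √(e^2+m^2)
    set b := √(e^2+m'^2)
    have h1 : |a - b| * (a + b) = |m - m'| * |m + m'| := by
      rw [← abs_of_pos (show 0 < a + b by positivity), ← abs_mul, ← abs_mul]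
      congr 1
      nlinarith
    have h2 : |m + m'| ≤ a + b := (abs_add_le _ _).trans (by linarith)
    have h3 : |a - b| * (a + b) ≤ |m - m'| * (a + b) := by
      rw [h1]; exact mul_le_mul_of_nonneg_left h2 (abs_nonneg _)
    exact le_of_mul_le_mul_right h3 (by positivity)
  have : PhiF e m - PhiF e m' = (√(e^2+m^2) - √(e^2+m'^2)) + (m - m') := by
    unfold PhiF; ring
  rw [this]
  exact (abs_add_le _ _).trans (by linarith)

lemma PhiF_mono (e : ℝ) (he : 0 < e) : Monotone (PhiF e) := by
  intro m m' h
  have h1 : |√(e^2+m^2) - √(e^2+m'^2)| ≤ |m - m'| := by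
    have ha : |m| ≤ √(e^2+m^2) := Real.abs_le_sqrt (by nlinarith)
    have hb : |m'| ≤ √(e^2+m'^2) := Real.abs_le_sqrt (by nlinarith)
    have ha2 := Real.sq_sqrt (show 0 ≤ e^2+m^2 by positivity)
    have hb2 := Real.sq_sqrt (show 0 ≤ e^2+m'^2 by positivity)
    have ha0 : 0 < √(e^2+m^2) := by positivity
    have hb0 : 0 < √(e^2+m'^2) := by positivity
    set a := √(e^2+m^2)
    set b := √(e^2+m'^2)
    have h1 : |a - b| * (a + b) = |m - m'| * |m + m'| := by
      rw [← abs_of_pos (show 0 < a + b by positivity), ← abs_mul, ← abs_mul]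
      congr 1
      nlinarith
    have h2 : |m + m'| ≤ a + b := (abs_add_le _ _).trans (by linarith)
    have h3 : |a - b| * (a + b) ≤ |m - m'| * (a + b) := by
      rw [h1]; exact mul_le_mul_of_nonneg_left h2 (abs_nonneg _)
    exact le_of_mul_le_mul_right h3 (by positivity)
  rw [abs_of_nonpos (show m - m' ≤ 0 by linarith)] at h1
  have := (abs_le.1 h1).2
  unfold PhiF
  linarith

/-- Second order lower bound. -/
lemma PhiF_lower (e m y : ℝ) (he : 0 < e) :
    PhiF e m + (1 + m / √(e^2+m^2)) * y +
      (if |m| ≤ e then (1:ℝ) else 0) * ((y^2 - y^4/e^2) / (12 * e)) ≤ PhiF e (m + y) := by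
  have ha2 := Real.sq_sqrt (show 0 ≤ e^2+m^2 by positivity)
  have hb2 := Real.sq_sqrt (show 0 ≤ e^2+(m+y)^2 by positivity)
  have ha0 : 0 < √(e^2+m^2) := by positivity
  have hb0 : 0 < √(e^2+(m+y)^2) := by positivity
  unfold PhiF
  set a := √(e^2+m^2)
  set b := √(e^2+(m+y)^2)
  have hab : a^2 + m*y ≤ a*b := by
    apply le_of_abs_le
    rw [← abs_of_pos (show 0 < a * b by positivity)]
    apply sq_le_sq.1
    rw [mul_pow, hb2]
    have : a^2 * (e^2 + (m+y)^2) - (a^2+m*y)^2 = e^2*y^2 := by rw [ha2]; ring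
    nlinarith [mul_nonneg (sq_nonneg e) (sq_nonneg y)]
  have hq : e^2*y^2 / (2*a^2*b) ≤ b - a - m*y/a := by
    have h1 : b - a - m*y/a = (a*b - a^2 - m*y)/a := by field_simp
    rw [h1, div_le_div_iff₀ (by positivity) ha0]
    have h2 : (a*b - (a^2 + m*y)) * (a*b + (a^2+m*y)) = e^2*y^2 := by
      have : (a*b - (a^2 + m*y)) * (a*b + (a^2+m*y)) = a^2*b^2 - (a^2+m*y)^2 := by ring
      rw [this, hb2, ha2]; ring
    have h3 : e^2*y^2 ≤ (a*b - (a^2 + m*y)) * (2*(a*b)) := by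
      rw [← h2]
      exact mul_le_mul_of_nonneg_left (by linarith) (by linarith)
    nlinarith
  have hgoal : (if |m| ≤ e then (1:ℝ) else 0) * ((y^2 - y^4/e^2) / (12 * e)) ≤
      b - a - m*y/a := by
    refine le_trans ?_ hq
    split_ifs with hm
    · rw [one_mul]
      by_cases hy : |y| ≤ e
      · have hm2 : m^2 ≤ e^2 := sq_le_sq' (by linarith [(abs_le.1 hm).1]) (abs_le.1 hm).2
        have hy2 : y^2 ≤ e^2 := sq_le_sq' (by linarith [(abs_le.1 hy).1]) (abs_le.1 hy).2
        have hb3 : b ≤ 3 * e := by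
          apply Real.sqrt_le_iff.2 ⟨by positivity, by nlinarith [sq_nonneg (m-y)]⟩
        have h4 : (y^2 - y^4/e^2) / (12*e) ≤ y^2/(12*e) := by
          apply div_le_div_of_nonneg_right _ (by positivity)
          have : 0 ≤ y^4/e^2 := by positivity
          linarith
        refine h4.trans ?_
        rw [div_le_div_iff₀ (by positivity) (by positivity)]
        have h5 : 2*a^2*b ≤ 12 * e^3 := by
          have : a^2 ≤ 2*e^2 := by rw [ha2]; linarith
          calc 2*a^2*b ≤ 2*(2*e^2)*(3*e) := by gcongr
            _ = _ := by ring
        nlinarith [mul_le_mul_of_nonneg_left h5 (sq_nonneg y)]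
      · have h0 : y^2 - y^4/e^2 ≤ 0 := by
          have : e^2 ≤ y^2 := sq_le_sq.2 (by rw [abs_of_pos he]; linarith)
          rw [sub_nonpos, le_div_iff₀ (by positivity)]
          nlinarith [sq_nonneg y]
        exact (div_nonpos_of_nonpos_of_nonneg h0 (by positivity)).trans (by positivity)
    · rw [zero_mul]; positivity
  have : (1 + m/a)*y = y + m*y/a := by ring
  rw [this]
  linarith

noncomputable def lin {p : ℕ} (u z : Fin p → ℝ) : ℝ := ∑ k, u k * z k

lemma lin_meas {p : ℕ} (u : Fin p → ℝ) : Measurable (lin u) :=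
  Finset.measurable_sum _ fun k _ => (measurable_pi_apply k).const_mul _

lemma lin_add {p : ℕ} (u z w : Fin p → ℝ) (s : ℝ) : lin u (z + s • w) = lin u z + s * lin u w := by
  unfold lin
  rw [Finset.mul_sum, ← Finset.sum_add_distrib]
  refine Finset.sum_congr rfl fun k _ => by simp; ring

lemma lin_smul {p : ℕ} (u z : Fin p → ℝ) (s : ℝ) : lin u (s • z) = s * lin u z := by
  unfold lin
  rw [Finset.mul_sum]
  refine Finset.sum_congr rfl fun k _ => by simp; ring

lemma lin_law {p : ℕ} (u : Fin p → ℝ) (hu : ∑ k, u k ^ 2 = 1) :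
    (gam p).map (lin u) = gaussianReal 0 1 := law_dot u hu

lemma gr_int_pow (n : ℕ) : Integrable (fun x : ℝ => x ^ n) (gaussianReal 0 1) := by
  rcases Nat.eq_zero_or_pos n with rfl | hn
  · simp
  · have := (memLp_id_gaussianReal' (μ := 0) (v := 1) n (by simp)).integrable_norm_pow (by omega)
    refine this.mono (by fun_prop) (by simp)

lemma gr_sq : ∫ x, x ^ 2 ∂(gaussianReal 0 1) = 1 := by
  have h := variance_fun_id_gaussianReal (μ := 0) (v := 1)
  rw [variance_eq_sub (X := fun x : ℝ => x) (memLp_id_gaussianReal' (μ := 0) (v := 1) 2 (by simp))] at h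
  simpa using h

lemma lin_int {p : ℕ} (u : Fin p → ℝ) (hu : ∑ k, u k ^ 2 = 1) {f : ℝ → ℝ}
    (hf : Integrable f (gaussianReal 0 1)) : Integrable (fun z => f (lin u z)) (gam p) := by
  rw [← lin_law u hu] at hf
  exact hf.comp_measurable (lin_meas u)

lemma lin_integral {p : ℕ} (u : Fin p → ℝ) (hu : ∑ k, u k ^ 2 = 1) {f : ℝ → ℝ}
    (hf : Integrable f (gaussianReal 0 1)) :
    ∫ z, f (lin u z) ∂(gam p) = ∫ x, f x ∂(gaussianReal 0 1) := by
  rw [← lin_law u hu] at hf ⊢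
  rw [integral_map (lin_meas u).aemeasurable hf.aestronglyMeasurable]

lemma gr_exp (t c : ℝ) : ∫ x, exp (t * x - c) ∂(gaussianReal 0 1) = exp (t^2/2 - c) := by
  have h := congrFun (mgf_fun_id_gaussianReal (μ := 0) (v := 1)) t
  simp only [mgf] at h
  simp_rw [sub_eq_add_neg, Real.exp_add]
  rw [integral_mul_const, h]
  simp

lemma gr_exp_int (t c : ℝ) : Integrable (fun x => exp (t * x - c)) (gaussianReal 0 1) := by
  simp_rw [sub_eq_add_neg, Real.exp_add]
  exact (integrable_exp_mul_gaussianReal t).mul_const _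

lemma exists_B {p : ℕ} (u : Fin p → Fin p → ℝ) (hu : ∀ i, ∑ k, u i k ^ 2 = 1)
    (L : ℝ) (hL : 1 ≤ L) (hLp : exp (L^2) = exp 1 * p) (hp : 0 < p) :
    ∃ B : (Fin p → ℝ) → ℝ, Integrable B (gam p) ∧ ∫ z, B z ∂(gam p) ≤ 4 * L ∧
      ∀ i z, |lin (u i) z| ≤ B z := by
  have hL0 : 0 < L := by linarith
  have hint : ∀ i, Integrable (fun z => exp (L * lin (u i) z - 2*L^2) +
      exp ((-L) * lin (u i) z - 2*L^2)) (gam p) := fun i =>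
    (lin_int (u i) (hu i) (gr_exp_int L (2*L^2))).add
      (lin_int (u i) (hu i) (gr_exp_int (-L) (2*L^2)))
  have hsint : Integrable (fun z => ∑ i, (exp (L * lin (u i) z - 2*L^2) +
      exp ((-L) * lin (u i) z - 2*L^2))) (gam p) :=
    integrable_finsetSum _ fun i _ => hint i
  refine ⟨fun z => 2 * L + (1/L) * ∑ i, (exp (L * lin (u i) z - 2*L^2) +
      exp ((-L) * lin (u i) z - 2*L^2)), (integrable_const _).add (hsint.const_mul _), ?_, ?_⟩
  · rw [integral_add (integrable_const _) (hsint.const_mul _), integral_const_mul (1/L),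
      integral_finsetSum _ (fun i _ => hint i)]
    have h1 : ∀ i, ∫ z, (exp (L * lin (u i) z - 2*L^2) +
      exp ((-L) * lin (u i) z - 2*L^2)) ∂(gam p) = 2 * exp (L^2/2 - 2*L^2) := by
      intro i
      rw [integral_add (lin_int (u i) (hu i) (gr_exp_int L (2*L^2)))
        (lin_int (u i) (hu i) (gr_exp_int (-L) (2*L^2))),
        lin_integral (u i) (hu i) (gr_exp_int L (2*L^2)),
        lin_integral (u i) (hu i) (gr_exp_int (-L) (2*L^2)), gr_exp, gr_exp]
      rw [neg_sq]; ring
    simp_rw [h1]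
    have h2 : (p:ℝ) * exp (L^2/2 - 2*L^2) ≤ 1 := by
      have h3 : exp (L^2/2 - 2*L^2) ≤ exp (-L^2) := exp_le_exp.2 (by nlinarith [sq_nonneg L])
      have hp' : (p:ℝ) ≤ exp (L^2) := by
        rw [hLp]
        have : (1:ℝ) ≤ exp 1 := Real.one_le_exp (by norm_num)
        nlinarith [Nat.cast_nonneg (α := ℝ) p]
      calc (p:ℝ) * exp (L^2/2 - 2*L^2) ≤ exp (L^2) * exp (-L^2) := by gcongr
        _ = 1 := by rw [← Real.exp_add]; simp
    have h4 : 1 / L ≤ L := by rw [div_le_iff₀ hL0]; nlinarith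
    simp only [integral_const, Finset.sum_const, Finset.card_univ, Fintype.card_fin, nsmul_eq_mul,
      probReal_univ, one_smul]
    have h5 : (1/L) * ((p:ℝ) * (2 * exp (L^2/2 - 2*L^2))) ≤ L * 2 := by
      apply mul_le_mul h4 (by linarith) (by positivity) hL0.le
    linarith
  · intro i z
    have h1 : exp (L * |lin (u i) z| - 2 * L^2) ≤ ∑ i, (exp (L * lin (u i) z - 2*L^2) +
      exp ((-L) * lin (u i) z - 2*L^2)) := by
      refine le_trans ?_ (Finset.single_le_sum (f := fun i => exp (L * lin (u i) z - 2*L^2) +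
        exp ((-L) * lin (u i) z - 2*L^2)) (fun j _ => by positivity) (Finset.mem_univ i))
      rcases abs_cases (lin (u i) z) with ⟨h, _⟩ | ⟨h, _⟩
      · rw [h]; have := exp_pos ((-L) * lin (u i) z - 2*L^2); linarith
      · rw [h, mul_neg, ← neg_mul]; have := exp_pos (L * lin (u i) z - 2*L^2); linarith
    have h2 := (Real.add_one_le_exp (L * |lin (u i) z| - 2 * L^2)).trans h1
    set T := ∑ i, (exp (L * lin (u i) z - 2*L^2) + exp ((-L) * lin (u i) z - 2*L^2))
    have h3 : L * |lin (u i) z| ≤ L * (2 * L + 1/L*T) := by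
      have : L * (2 * L + 1/L*T) = 2*L^2 + T := by field_simp
      rw [this]; linarith
    exact le_of_mul_le_mul_left h3 hL0

lemma main_bound {p : ℕ} (hp : 0 < p) (u : Fin p → Fin p → ℝ) (hu : ∀ i, ∑ k, u i k ^ 2 = 1)
    (b : Fin p → ℝ) (L : ℝ) (hL : 1 ≤ L) (hLp : exp (L^2) = exp 1 * p) (e : ℝ) (he : 0 < e) :
    (gam p).real {z | (∀ i, lin (u i) z - b i ≤ e) ∧ ∃ i, -e ≤ lin (u i) z - b i} ≤
      96 * e * L := by
  obtain ⟨B, hBi, hB4, hB⟩ := exists_B u hu L hL hLp hp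
  have hne : (Finset.univ : Finset (Fin p)).Nonempty := ⟨⟨0, hp⟩, Finset.mem_univ _⟩
  set M : (Fin p → ℝ) → ℝ := fun z => Finset.univ.sup' hne (fun i => lin (u i) z - b i) with hM
  have hMmeas : Measurable M := by
    have := Finset.measurable_sup' hne (f := fun i z => lin (u i) z - b i)
      (fun i _ => (lin_meas (u i)).sub_const (b i))
    convert this using 1
    ext z
    simp [hM, Finset.sup'_apply]
  have hMle : ∀ z i, lin (u i) z - b i ≤ M z := fun z i =>
    Finset.le_sup' (fun i => lin (u i) z - b i) (Finset.mem_univ i)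
  have hMex : ∀ z, ∃ i, M z = lin (u i) z - b i := fun z => by
    obtain ⟨i, _, h⟩ := Finset.exists_mem_eq_sup' hne (fun i => lin (u i) z - b i)
    exact ⟨i, h⟩
  have hMlip : ∀ w z D, (∀ i, |lin (u i) w - lin (u i) z| ≤ D) → |M w - M z| ≤ D := by
    intro w z D h
    obtain ⟨i, hi⟩ := hMex w
    obtain ⟨j, hj⟩ := hMex z
    rw [abs_le]
    constructor
    · have := hMle w j
      have := (abs_le.1 (h j)).1
      linarith
    · have := hMle z i
      have := (abs_le.1 (h i)).2
      linarith
  have hPc : Measurable (PhiF e) := by unfold PhiF; fun_prop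
  set g : (Fin p → ℝ) → ℝ := fun z => PhiF e (M z) with hg
  have hgm : Measurable g := hPc.comp hMmeas
  -- Integrability along dilations
  have hgint : ∀ c : ℝ, Integrable (fun z => g (c • z)) (gam p) := by
    intro c
    refine Integrable.mono' (g := fun z => |g 0| + 2 * (|c| * B z))
      ((integrable_const _).add ((hBi.const_mul _).const_mul _))
      (hgm.comp (measurable_const_smul c)).aestronglyMeasurable (ae_of_all _ fun z => ?_)
    have h1 := PhiF_lip e (M (c • z)) (M 0) he
    have h2 := hMlip (c • z) 0 (|c| * B z) (fun i => by
      have : lin (u i) 0 = 0 := by simp [lin]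
      rw [this, sub_zero, lin_smul, abs_mul]
      exact mul_le_mul_of_nonneg_left (hB i z) (abs_nonneg _))
    have h3 := abs_sub_abs_le_abs_sub (g (c • z)) (g 0)
    rw [Real.norm_eq_abs]
    have h4 : |g (c • z) - g 0| ≤ 2 * |M (c • z) - M 0| := h1
    linarith
  have hg1 : Integrable g (gam p) := by simpa using hgint 1
  set K : ℝ := ∫ x, x^4 ∂(gaussianReal 0 1) with hK
  have hK0 : 0 ≤ K := integral_nonneg fun x => by positivity
  set t : ℝ := e^2 / (2*K+1) with ht
  have ht0 : 0 < t := by positivity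
  set s : ℝ := √t with hs
  have hs2 : s^2 = t := Real.sq_sqrt ht0.le
  set c : ℝ := √(1+s^2) with hc
  -- convolution
  have hlaw := law_sum p s
  have hprodint : Integrable (fun x : (Fin p → ℝ) × (Fin p → ℝ) => g (x.1 + s • x.2))
      ((gam p).prod (gam p)) := by
    have h1 : Integrable g ((gam p).map (fun x => c • x)) := by
      rw [integrable_map_measure hgm.aestronglyMeasurable (by fun_prop)]
      exact hgint c
    rw [← hlaw] at h1
    exact h1.comp_measurable (by fun_prop)
  have hprodeq : ∫ x, g (x.1 + s • x.2) ∂((gam p).prod (gam p)) = ∫ z, g (c • z) ∂(gam p) := by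
    rw [← integral_map (φ := fun x : (Fin p → ℝ) × (Fin p → ℝ) => x.1 + s • x.2)
      (by fun_prop) hgm.aestronglyMeasurable, hlaw,
      integral_map (by fun_prop) hgm.aestronglyMeasurable]
  -- upper bound
  have hup : ∫ z, g (c • z) ∂(gam p) ≤ ∫ z, g z ∂(gam p) + t * (4 * L) := by
    have hc1 : 1 ≤ c := Real.one_le_sqrt.2 (by nlinarith [sq_nonneg s])
    have hct : 2 * (c - 1) ≤ t := by
      have : c^2 = 1 + t := by rw [hc, Real.sq_sqrt (by positivity), hs2]
      nlinarith [sq_nonneg (c-1)]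
    have h0 : ∫ z, g (c • z) ∂(gam p) ≤ ∫ z, (g z + t * B z) ∂(gam p) := by
      refine integral_mono (hgint c) (hg1.add (hBi.const_mul _)) fun z => ?_
      have h1 := PhiF_lip e (M (c • z)) (M z) he
      have h2 := hMlip (c • z) z ((c - 1) * B z) (fun i => by
        rw [lin_smul, show c * lin (u i) z - lin (u i) z = (c-1) * lin (u i) z by ring, abs_mul,
          abs_of_nonneg (by linarith : 0 ≤ c - 1)]
        exact mul_le_mul_of_nonneg_left (hB i z) (by linarith))
      have h4 : g (c • z) - g z ≤ 2 * |M (c • z) - M z| := (le_abs_self _).trans h1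
      have hB0 : 0 ≤ B z := (abs_nonneg _).trans (hB ⟨0, hp⟩ z)
      simp only
      nlinarith [mul_le_mul_of_nonneg_right hct hB0]
    rw [integral_add hg1 (hBi.const_mul _), integral_const_mul] at h0
    nlinarith [mul_le_mul_of_nonneg_left hB4 ht0.le]
  -- lower bound
  set E : Set (Fin p → ℝ) := {z | |M z| ≤ e} with hE
  have hEm : MeasurableSet E := measurableSet_le (by fun_prop) measurable_const
  set κ : ℝ := (t - t^2 * K / e^2) / (12 * e) with hκ
  have hlow : ∫ z, (g z + E.indicator (fun _ => κ) z) ∂(gam p) ≤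
      ∫ x, g (x.1 + s • x.2) ∂((gam p).prod (gam p)) := by
    rw [integral_prod _ hprodint]
    refine integral_mono_ae (hg1.add ((integrable_const κ).indicator hEm))
      hprodint.integral_prod_left ?_
    filter_upwards [hprodint.prod_right_ae] with z hz
    obtain ⟨i, hi⟩ := hMex z
    set q : ℝ := if |M z| ≤ e then 1 else 0 with hq
    set d : ℝ := 1 + M z / √(e^2 + (M z)^2) with hd
    have hpt : ∀ w, g z + d * (s * lin (u i) w) +
        q * (((s * lin (u i) w)^2 - (s * lin (u i) w)^4/e^2) / (12 * e)) ≤ g (z + s • w) := by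
      intro w
      refine (PhiF_lower e (M z) (s * lin (u i) w) he).trans (PhiF_mono e he ?_)
      have := hMle (z + s • w) i
      rw [lin_add] at this
      linarith
    have i1 := lin_int (u i) (hu i) (gr_int_pow 1)
    have i2 := lin_int (u i) (hu i) (gr_int_pow 2)
    have i4 := lin_int (u i) (hu i) (gr_int_pow 4)
    have e1 := lin_integral (u i) (hu i) (gr_int_pow 1)
    have e2 := lin_integral (u i) (hu i) (gr_int_pow 2)
    have e4 := lin_integral (u i) (hu i) (gr_int_pow 4)
    rw [gr_sq] at e2
    rw [← hK] at e4
    simp only [pow_one, integral_id_gaussianReal] at e1 i1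
    have hpt' : ∀ w, (g z + (d * s) * lin (u i) w) + ((q * t / (12*e)) * lin (u i) w ^ 2 -
        (q * t^2 / e^2 / (12 * e)) * lin (u i) w ^ 4) ≤ g (z + s • w) := by
      intro w
      refine le_trans (le_of_eq ?_) (hpt w)
      rw [← hs2]
      field_simp
    have hI1 : Integrable (fun w => g z + (d * s) * lin (u i) w) (gam p) :=
      (integrable_const _).add (i1.const_mul _)
    have hI2 : Integrable (fun w => (q * t / (12*e)) * lin (u i) w ^ 2 -
        (q * t^2 / e^2 / (12 * e)) * lin (u i) w ^ 4) (gam p) :=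
      (i2.const_mul _).sub (i4.const_mul _)
    have h := integral_mono (hI1.add hI2) hz hpt'
    simp only [Pi.add_apply] at h
    rw [integral_add hI1 hI2, integral_add (integrable_const _) (i1.const_mul _),
      integral_sub (i2.const_mul _) (i4.const_mul _), integral_const_mul, integral_const_mul,
      integral_const_mul, e1, e2, e4] at h
    simp only [integral_const, probReal_univ, one_smul, mul_zero, add_zero, mul_one] at h
    refine le_trans (le_of_eq ?_) h
    have hqi : E.indicator (fun _ => κ) z = q * κ := by
      by_cases hz' : |M z| ≤ e
      · have : z ∈ E := hz'
        simp [this, hq, hz']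
      · have : z ∉ E := hz'
        simp [this, hq, hz']
    rw [hqi, hκ]
    field_simp
  rw [integral_add hg1 ((integrable_const κ).indicator hEm), integral_indicator_const _ hEm,
    smul_eq_mul, hprodeq] at hlow
  have hfin : (gam p).real E * κ ≤ t * (4 * L) := by linarith
  have hκ2 : t / (24 * e) ≤ κ := by
    have h1 : t * K / e^2 ≤ 1/2 := by
      rw [ht, div_le_div_iff₀ (by positivity) (by positivity)]
      rw [div_mul_eq_mul_div, div_mul_eq_mul_div, div_le_iff₀ (by positivity)]
      nlinarith [sq_nonneg e]
    have h2 : t^2 * K / e^2 = t * (t * K / e^2) := by ring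
    rw [hκ, h2, div_le_div_iff₀ (by positivity) (by positivity)]
    have : t * (t * K / e^2) ≤ t * (1/2) := mul_le_mul_of_nonneg_left h1 ht0.le
    nlinarith
  have hEb : (gam p).real E ≤ 96 * e * L := by
    have h1 : (gam p).real E * (t / (24 * e)) ≤ t * (4 * L) :=
      (mul_le_mul_of_nonneg_left hκ2 measureReal_nonneg).trans hfin
    have h2 : (96 * e * L) * (t / (24 * e)) = t * (4 * L) := by field_simp; ring
    rw [← h2] at h1
    exact le_of_mul_le_mul_right h1 (by positivity)
  refine le_trans (measureReal_mono ?_ ) hEb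
  rintro z ⟨h1, i, h2⟩
  obtain ⟨j, hj⟩ := hMex z
  have := hMle z i
  have := h1 j
  show |M z| ≤ e
  rw [abs_le]
  exact ⟨by linarith, by linarith⟩

theorem stmt0 :
    ∃ C : ℝ, 0 < C ∧
      ∀ (p : ℕ), 0 < p →
      ∀ (Ω : Type) [MeasurableSpace Ω] (P : Measure Ω) [IsProbabilityMeasure P]
        (Y : Ω → Fin p → ℝ) (S : Matrix (Fin p) (Fin p) ℝ),
        IsCenteredGaussianLaw P Y S → (∀ i, 0 < S i i) →
        ∀ (r : Fin p → ℝ) (δ : ℝ), 0 ≤ δ →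
          (P {ω | Y ω ∈ slab r δ}).toReal ≤
            C * δ * Real.sqrt (Real.log (Real.exp 1 * p) / (⨅ i, S i i)) := by
  refine ⟨96, by norm_num, ?_⟩
  intro p hp Ω _ P _ Y S hG hS r δ hδ
  obtain ⟨A, hSA, hlaw⟩ := hG
  have : Nonempty (Fin p) := ⟨⟨0, hp⟩⟩
  rcases hδ.eq_or_lt with rfl | hδ
  · simp [slab]
  set m : ℝ := ⨅ i, S i i with hm
  have hmle : ∀ i, m ≤ S i i := fun i => ciInf_le (Finite.bddBelow_range _) i
  have hm0 : 0 < m := by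
    obtain ⟨i, hi⟩ := exists_eq_ciInf_of_finite (f := fun i => S i i)
    rw [hm, ← hi]; exact hS i
  have hSii : ∀ i, S i i = ∑ k, A i k ^ 2 := fun i => by
    rw [hSA, Matrix.mul_apply]
    exact Finset.sum_congr rfl fun k _ => by simp [sq]
  set a : Fin p → ℝ := fun i => √(S i i) with ha
  have ha0 : ∀ i, 0 < a i := fun i => Real.sqrt_pos.2 (hS i)
  have ha2 : ∀ i, a i ^ 2 = S i i := fun i => Real.sq_sqrt (hS i).le
  set l : ℝ := √m with hl
  have hl0 : 0 < l := Real.sqrt_pos.2 hm0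
  have hla : ∀ i, l ≤ a i := fun i => Real.sqrt_le_sqrt (hmle i)
  have hp1 : (1:ℝ) ≤ p := by exact_mod_cast hp
  have hlog : 1 ≤ Real.log (Real.exp 1 * p) := by
    rw [Real.log_mul (Real.exp_pos 1).ne' (by positivity), Real.log_exp]
    linarith [Real.log_nonneg hp1]
  set L : ℝ := √(Real.log (Real.exp 1 * p)) with hL
  have hL1 : 1 ≤ L := Real.one_le_sqrt.2 hlog
  have hLp : exp (L^2) = exp 1 * p := by
    rw [hL, Real.sq_sqrt (by linarith), Real.exp_log (by positivity)]
  have key := main_bound hp (fun i k => A i k / a i) (fun i => by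
    simp_rw [div_pow]
    rw [← Finset.sum_div, ← hSii, ha2, div_self (hS i).ne']) (fun i => r i / a i) L hL1 hLp
    (δ / l) (by positivity)
  have hrhs : 96 * δ * √(Real.log (Real.exp 1 * p) / m) = 96 * (δ / l) * L := by
    rw [Real.sqrt_div (by linarith)]
    ring
  rw [hrhs]
  refine le_trans ?_ key
  have hYm : AEMeasurable Y P := by
    by_contra h
    rw [Measure.map_of_not_aemeasurable h] at hlaw
    have hA : Measurable (fun z : Fin p → ℝ => A.mulVec z) := by
      refine measurable_pi_iff.2 fun i => ?_
      exact lin_meas (A i)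
    have h2 : (Measure.map (fun z : Fin p → ℝ => A.mulVec z) (gam p)) Set.univ = 1 := by
      rw [Measure.map_apply hA MeasurableSet.univ]; simp
    have h3 : (0 : Measure (Fin p → ℝ)) Set.univ = 1 := by rw [hlaw]; exact h2
    simp at h3
  have hA : Measurable (fun z : Fin p → ℝ => A.mulVec z) :=
    measurable_pi_iff.2 fun i => lin_meas (A i)
  have hsm : MeasurableSet (slab r δ) := by
    refine MeasurableSet.diff ?_ ?_ <;>
    · rw [Set.ofPred_forall]
      exact MeasurableSet.iInter fun k => measurableSet_le (measurable_pi_apply k) measurable_const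
  have h1 : P {ω | Y ω ∈ slab r δ} = gam p {z | A.mulVec z ∈ slab r δ} := by
    have e1 := Measure.map_apply_of_aemeasurable hYm hsm
    have e2 := Measure.map_apply (μ := gam p) hA hsm
    rw [hlaw] at e1
    exact e1.symm.trans e2
  rw [h1]
  refine measureReal_mono ?_
  intro z hz
  have hlin : ∀ i, lin (fun k => A i k / a i) z - r i / a i = (A.mulVec z i - r i) / a i := by
    intro i
    rw [sub_div]
    congr 1
    simp only [lin, Matrix.mulVec, dotProduct]
    rw [Finset.sum_div]
    exact Finset.sum_congr rfl fun k _ => by ring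
  obtain ⟨hz1, hz2⟩ := hz
  have hle : ∀ i, δ / a i ≤ δ / l := fun i => by
    apply div_le_div_of_nonneg_left hδ.le hl0 (hla i)
  simp only [Set.mem_ofPred_eq, not_forall, not_le] at hz1 hz2
  obtain ⟨i, hi⟩ := hz2
  refine ⟨fun j => ?_, i, ?_⟩
  · rw [hlin]
    refine le_trans ?_ (hle j)
    have := hz1 j
    exact div_le_div_of_nonneg_right (by linarith) (ha0 j).le
  · rw [hlin]
    have h2 : -δ / a i ≤ (A.mulVec z i - r i) / a i :=
      div_le_div_of_nonneg_right (by linarith) (ha0 i).le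
    rw [neg_div] at h2
    linarith [hle i]
end

section
/- Let X be any random vector in R^p, let Y ~ N(0,Σ) be Gaussian with min_i Σ_ii > 0, and let Z be a standard Gaussian vector in R^p independent of both. Then for every ε > 0, the Kolmogorov distance over hyper-rectangles satisfies μ(X, Y) ≤ C·μ(X + εZ, Y + εZ) + C·ε·log(e·p)/sqrt(min_i Σ_ii) for some absolute constant C > 0. -/
open MeasureTheory ProbabilityTheory Real
open scoped Classical

lemma gs_upper {s : Set ℝ} {a b M : ℝ} (hM : 0 ≤ M) (hs : s ⊆ Set.Icc a b)
    (h : ∀ x ∈ Set.Icc a b, gaussianPDFReal 0 1 x ≤ M) :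
    gaussianReal 0 1 s ≤ ENNReal.ofReal (M * (b - a)) := by
  calc gaussianReal 0 1 s ≤ gaussianReal 0 1 (Set.Icc a b) := measure_mono hs
    _ = ∫⁻ x in Set.Icc a b, gaussianPDF 0 1 x := gaussianReal_apply 0 one_ne_zero _
    _ ≤ ∫⁻ x in Set.Icc a b, ENNReal.ofReal M :=
        setLIntegral_mono' measurableSet_Icc fun x hx => ENNReal.ofReal_le_ofReal (h x hx)
    _ = ENNReal.ofReal (M * (b - a)) := by
        rw [setLIntegral_const, Real.volume_Icc, ENNReal.ofReal_mul hM]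

lemma gs_lower {s : Set ℝ} {a b M : ℝ} (hM : 0 ≤ M) (hs : Set.Ioc a b ⊆ s)
    (h : ∀ x ∈ Set.Ioc a b, M ≤ gaussianPDFReal 0 1 x) :
    ENNReal.ofReal (M * (b - a)) ≤ gaussianReal 0 1 s := by
  calc ENNReal.ofReal (M * (b - a)) = ∫⁻ x in Set.Ioc a b, ENNReal.ofReal M := by
        rw [setLIntegral_const, Real.volume_Ioc, ENNReal.ofReal_mul hM]
    _ ≤ ∫⁻ x in Set.Ioc a b, gaussianPDF 0 1 x :=
        setLIntegral_mono' measurableSet_Ioc fun x hx => ENNReal.ofReal_le_ofReal (h x hx)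
    _ = gaussianReal 0 1 (Set.Ioc a b) := (gaussianReal_apply 0 one_ne_zero _).symm
    _ ≤ _ := measure_mono hs

lemma pdf_std (x : ℝ) : gaussianPDFReal 0 1 x = (√(2 * π))⁻¹ * Real.exp (-(x ^ 2) / 2) := by
  simp [gaussianPDFReal]

lemma c0_pos : 0 < (√(2 * π))⁻¹ := by positivity

lemma c0_le : (√(2 * π))⁻¹ ≤ 1 := by
  apply inv_le_one_of_one_le₀
  rw [Real.one_le_sqrt]
  nlinarith [Real.pi_gt_three]

lemma one_dim {V : Set ℝ} (hV : IsUpperSet V) {b t L κ : ℝ} (hVb : V ⊆ Set.Ioi b) (ht : 0 ≤ t)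
    (ht1 : t ≤ 1) (hL : 0 ≤ L) (hκ : Real.exp (-(L ^ 2) / 2) ≤ κ) :
    gaussianReal 0 1 (V ∩ Set.Iic (b + t)) ≤
      ENNReal.ofReal (Real.exp (3 / 2) * (2 + L) * t) * gaussianReal 0 1 V
        + ENNReal.ofReal (κ * t) := by
  have hκ0 : 0 ≤ κ := (Real.exp_pos _).le.trans hκ
  by_cases hb : L < b
  · refine le_trans ?_ le_add_self
    have := gs_upper (s := V ∩ Set.Iic (b + t)) (a := b) (b := b + t) hκ0
      (fun x hx => ⟨(hVb hx.1).le, hx.2⟩) ?_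
    · simpa using this
    · intro x hx
      rw [pdf_std]
      have : Real.exp (-(x ^ 2) / 2) ≤ Real.exp (-(L ^ 2) / 2) := by
        apply Real.exp_le_exp.2
        nlinarith [hx.1]
      nlinarith [c0_pos, c0_le, Real.exp_pos (-(x ^ 2) / 2)]
  push Not at hb
  refine le_trans ?_ le_self_add
  rcases (V ∩ Set.Iic (b + t)).eq_empty_or_nonempty with he | ⟨x0, hx0⟩
  · simp [he]
  have hbdd : BddBelow V := ⟨b, fun x hx => (hVb hx).le⟩
  set m := sInf V with hm
  have hmb : b ≤ m := le_csInf ⟨x0, hx0.1⟩ fun x hx => (hVb hx).le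
  have hmt : m ≤ b + t := (csInf_le hbdd hx0.1).trans hx0.2
  set M := max m 0 with hMdef
  have hM0 : 0 ≤ M := le_max_right _ _
  have hmM : m ≤ M := le_max_left _ _
  have hML : M ≤ L + 1 := max_le (by linarith) (by linarith)
  set E := (√(2 * π))⁻¹ * Real.exp (-(M ^ 2) / 2) with hE
  have hE0 : 0 < E := by positivity
  have h1 : gaussianReal 0 1 (V ∩ Set.Iic (b + t)) ≤ ENNReal.ofReal (E * t) := by
    refine (gs_upper (a := m) (b := b + t) hE0.le
      (fun x hx => ⟨csInf_le hbdd hx.1, hx.2⟩) ?_).trans ?_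
    · intro x hx
      rw [pdf_std]
      refine mul_le_mul_of_nonneg_left (Real.exp_le_exp.2 ?_) c0_pos.le
      have : M ^ 2 ≤ x ^ 2 := by
        rcases max_cases m 0 with h | h
        · rw [hMdef, h.1]; nlinarith [hx.1]
        · rw [hMdef, h.1]; nlinarith
      linarith
    · apply ENNReal.ofReal_le_ofReal
      nlinarith
  have h2 : ENNReal.ofReal (E * Real.exp (-(3 / 2)) * (1 / (1 + M))) ≤ gaussianReal 0 1 V := by
    have := gs_lower (s := V) (a := M) (b := M + 1 / (1 + M)) (M := E * Real.exp (-(3 / 2)))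
      (by positivity) ?_ ?_
    · simpa using this
    · intro x hx
      obtain ⟨y, hy, hyx⟩ := exists_lt_of_csInf_lt ⟨x0, hx0.1⟩ (lt_of_le_of_lt hmM hx.1)
      exact hV hyx.le hy
    · intro x hx
      rw [pdf_std, hE, mul_assoc, ← Real.exp_add]
      refine mul_le_mul_of_nonneg_left (Real.exp_le_exp.2 ?_) c0_pos.le
      set u := 1 / (1 + M) with hu
      have hu1 : u * (1 + M) = 1 := by rw [hu]; field_simp
      have hu0 : 0 < u := by positivity
      have hx2 := hx.2
      have : x ^ 2 ≤ (M + u) ^ 2 := by nlinarith [hx.1]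
      nlinarith
  refine h1.trans (le_trans ?_ (mul_le_mul_right h2 _))
  rw [← ENNReal.ofReal_mul (by positivity)]
  apply ENNReal.ofReal_le_ofReal
  have h3 : Real.exp (3 / 2) * Real.exp (-(3 / 2)) = 1 := by rw [← Real.exp_add]; simp
  have : Real.exp (3 / 2) * (2 + L) * t * (E * Real.exp (-(3 / 2)) * (1 / (1 + M)))
    = E * t * ((2 + L) / (1 + M)) * (Real.exp (3 / 2) * Real.exp (-(3 / 2))) := by ring
  rw [this, h3, mul_one]
  have : 1 ≤ (2 + L) / (1 + M) := by rw [le_div_iff₀ (by linarith)]; linarith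
  have : 0 ≤ E * t := by positivity
  nlinarith

lemma indep_gauss {Ω : Type*} [MeasurableSpace Ω] (P : Measure Ω) {p : ℕ}
    (W : Fin p → Ω → ℝ) (hW : HasGaussianLaw (fun ω => (W · ω)) P)
    (hv : ∀ k, Var[W k; P] = 1) (k : Fin p) :
    IndepFun (W k) (fun ω j => W j ω - cov[W j, W k; P] * W k ω) P := by
  have := hW.isProbabilityMeasure
  have hL2 : ∀ j, MemLp (W j) 2 P := fun j => (hW.eval j).memLp_two
  have key : IndepFun (fun ω (_ : Unit) => W k ω)
      (fun ω j => W j ω - cov[W j, W k; P] * W k ω) P := by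
    apply HasGaussianLaw.indepFun_of_covariance_eval (X := fun _ => W k)
      (Y := fun j ω => W j ω - cov[W j, W k; P] * W k ω)
    · let Lm : (Fin p → ℝ) →L[ℝ] ((Unit → ℝ) × (Fin p → ℝ)) :=
        LinearMap.toContinuousLinearMap
        { toFun := fun x => (fun _ => x k, fun j => x j - cov[W j, W k; P] * x k)
          map_add' := by intro x y; ext <;> simp; ring
          map_smul' := by intro c x; ext <;> simp; ring }
      exact hW.map_fun Lm
    · intro _ j
      have : (fun ω => W j ω - cov[W j, W k; P] * W k ω) = W j - fun ω => cov[W j, W k; P] * W k ω := rfl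
      rw [this, covariance_sub_right (hL2 k) (hL2 j) ((hL2 k).const_mul _),
        covariance_const_mul_right, covariance_self (hW.eval k).aemeasurable, hv k,
        covariance_comm]
      simp
  exact key.comp (φ := fun f : Unit → ℝ => f ()) (ψ := id) (by fun_prop) measurable_id

lemma cov_le_one {Ω : Type*} [MeasurableSpace Ω] (P : Measure Ω) {p : ℕ}
    (W : Fin p → Ω → ℝ) (hW : HasGaussianLaw (fun ω => (W · ω)) P)
    (hv : ∀ k, Var[W k; P] = 1) (j k : Fin p) : cov[W j, W k; P] ≤ 1 := by
  have := hW.isProbabilityMeasure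
  have hL2 : ∀ j, MemLp (W j) 2 P := fun j => (hW.eval j).memLp_two
  have h := variance_sub (hL2 j) (hL2 k)
  have h0 := variance_nonneg (W j - W k) P
  rw [h, hv, hv] at h0
  linarith

lemma slice_bound {Ω F : Type*} [MeasurableSpace Ω] [MeasurableSpace F] (P : Measure Ω)
    [IsProbabilityMeasure P] (U : Ω → ℝ) (G : Ω → F) (hU : Measurable U) (hG : Measurable G)
    (hind : IndepFun U G P) (hlaw : P.map U = gaussianReal 0 1) (D : Set (ℝ × F))
    (hD : MeasurableSet D) {b t L κ : ℝ} (hup : ∀ g, IsUpperSet {w | (w, g) ∈ D})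
    (hb : ∀ g, {w | (w, g) ∈ D} ⊆ Set.Ioi b) (ht : 0 ≤ t)
    (ht1 : t ≤ 1) (hL : 0 ≤ L) (hκ : Real.exp (-(L ^ 2) / 2) ≤ κ) :
    P {ω | (U ω, G ω) ∈ D ∧ U ω ≤ b + t} ≤
      ENNReal.ofReal (Real.exp (3 / 2) * (2 + L) * t) * P {ω | (U ω, G ω) ∈ D}
        + ENNReal.ofReal (κ * t) := by
  have hprod : P.map (fun ω => (U ω, G ω)) = (gaussianReal 0 1).prod (P.map G) := by
    rw [(indepFun_iff_map_prod_eq_prod_map_map hU.aemeasurable hG.aemeasurable).1 hind, hlaw]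
  have : IsProbabilityMeasure (P.map G) := Measure.isProbabilityMeasure_map hG.aemeasurable
  have hD' : MeasurableSet (D ∩ {x | x.1 ≤ b + t}) :=
    hD.inter (measurableSet_le measurable_fst measurable_const)
  have e1 : P {ω | (U ω, G ω) ∈ D ∧ U ω ≤ b + t}
      = ∫⁻ g, gaussianReal 0 1 ({w | (w, g) ∈ D} ∩ Set.Iic (b + t)) ∂(P.map G) := by
    have h := Measure.map_apply (μ := P) (hU.prodMk hG) hD'
    rw [hprod, Measure.prod_apply_symm hD'] at h
    exact h.symm
  have e2 : P {ω | (U ω, G ω) ∈ D} = ∫⁻ g, gaussianReal 0 1 {w | (w, g) ∈ D} ∂(P.map G) := by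
    have h := Measure.map_apply (μ := P) (hU.prodMk hG) hD
    rw [hprod, Measure.prod_apply_symm hD] at h
    exact h.symm
  have hm : Measurable fun g => gaussianReal 0 1 {w | (w, g) ∈ D} :=
    measurable_measure_prodMk_right hD
  rw [e1, e2, ← lintegral_const_mul _ hm]
  calc _ ≤ ∫⁻ g, (ENNReal.ofReal (Real.exp (3 / 2) * (2 + L) * t) *
            gaussianReal 0 1 {w | (w, g) ∈ D} + ENNReal.ofReal (κ * t)) ∂(P.map G) :=
        lintegral_mono fun g => one_dim (hup g) (hb g) ht ht1 hL hκ
    _ = _ := by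
        rw [lintegral_add_right _ measurable_const]
        simp

lemma nazarov {Ω : Type*} [MeasurableSpace Ω] (P : Measure Ω) {p : ℕ}
    (W : Fin p → Ω → ℝ) (hWm : ∀ k, Measurable (W k)) (hW : HasGaussianLaw (fun ω => (W · ω)) P)
    (hv : ∀ k, Var[W k; P] = 1) (hlaw : ∀ k, P.map (W k) = gaussianReal 0 1)
    (b : Fin p → ℝ) {t L : ℝ} (ht : 0 ≤ t)
    (ht1 : t ≤ 1) (hL : 0 ≤ L) (hκ : Real.exp (-(L ^ 2) / 2) ≤ 1 / p) :
    P {ω | ∀ k, W k ω ≤ b k + t} ≤ P {ω | ∀ k, W k ω ≤ b k} +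
      ENNReal.ofReal ((Real.exp (3 / 2) * (2 + L) + 1) * t) := by
  have := hW.isProbabilityMeasure
  let ρ : Fin p → Fin p → ℝ := fun k j => cov[W j, W k; P]
  let G : Fin p → Ω → Fin p → ℝ := fun k ω j => W j ω - ρ k j * W k ω
  let D : Fin p → Set (ℝ × (Fin p → ℝ)) := fun k =>
    {x | b k < x.1 ∧ ∀ j, (j < k → ρ k j * x.1 + x.2 j - b j < x.1 - b k) ∧
      (k < j → ρ k j * x.1 + x.2 j - b j ≤ x.1 - b k)}
  have hGm : ∀ k, Measurable (G k) := fun k =>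
    measurable_pi_lambda _ fun j => (hWm j).sub ((hWm k).const_mul _)
  have hDm : ∀ k, MeasurableSet (D k) := by
    intro k
    have e : D k = {x | b k < x.1} ∩ ⋂ j, ({x | j < k → ρ k j * x.1 + x.2 j - b j < x.1 - b k} ∩
        {x | k < j → ρ k j * x.1 + x.2 j - b j ≤ x.1 - b k}) := by
      ext x; simp [D]
    rw [e]
    refine (measurableSet_lt measurable_const measurable_fst).inter
      (MeasurableSet.iInter fun j => MeasurableSet.inter ?_ ?_)
    · by_cases h : j < k
      · simp only [h, true_imp_iff]
        exact measurableSet_lt (by fun_prop) (by fun_prop)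
      · simp [h]
    · by_cases h : k < j
      · simp only [h, true_imp_iff]
        exact measurableSet_le (by fun_prop) (by fun_prop)
      · simp [h]
  let E : Fin p → Set Ω := fun k => {ω | (W k ω, G k ω) ∈ D k}
  have hEm : ∀ k, MeasurableSet (E k) := fun k => ((hWm k).prodMk (hGm k)) (hDm k)
  have hE : ∀ k ω, ω ∈ E k ↔ b k < W k ω ∧ ∀ j, (j < k → W j ω - b j < W k ω - b k) ∧
      (k < j → W j ω - b j ≤ W k ω - b k) := by
    intro k ω
    simp [E, D, G]
  have hdisj : Pairwise (Function.onFun Disjoint E) := by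
    intro i j hij
    rw [Function.onFun, Set.disjoint_left]
    intro ω hi hj
    rw [hE] at hi hj
    rcases lt_or_gt_of_ne hij with h | h
    · have h1 := (hi.2 j).2 h
      have h2 := (hj.2 i).1 h
      linarith
    · have h1 := (hi.2 j).1 h
      have h2 := (hj.2 i).2 h
      linarith
  have hk : ∀ k, P {ω | ω ∈ E k ∧ W k ω ≤ b k + t} ≤
      ENNReal.ofReal (Real.exp (3 / 2) * (2 + L) * t) * P (E k) + ENNReal.ofReal (1 / p * t) := by
    intro k
    refine slice_bound P (W k) (G k) (hWm k) (hGm k) (indep_gauss P W hW hv k) (hlaw k) (D k)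
      (hDm k) ?_ ?_ ht ht1 hL hκ
    · intro g x y hxy hx
      refine ⟨lt_of_lt_of_le hx.1 hxy, fun j => ?_⟩
      have hρ : ρ k j ≤ 1 := cov_le_one P W hW hv j k
      have : ρ k j * y - ρ k j * x ≤ y - x := by nlinarith
      have h2 := hx.2 j
      dsimp only at h2 ⊢
      exact ⟨fun h => by linarith [h2.1 h], fun h => by linarith [h2.2 h]⟩
    · intro g x hx
      exact hx.1
  have hcov : {ω | ∀ k, W k ω ≤ b k + t} ⊆ {ω | ∀ k, W k ω ≤ b k} ∪
      ⋃ k, {ω | ω ∈ E k ∧ W k ω ≤ b k + t} := by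
    intro ω hω
    by_cases h : ∀ k, W k ω ≤ b k
    · exact Or.inl h
    right
    push Not at h
    obtain ⟨k0, hk0⟩ := h
    obtain ⟨k1, -, hk1⟩ := Finset.exists_max_image Finset.univ (fun k => W k ω - b k)
      ⟨k0, Finset.mem_univ _⟩
    let T := Finset.univ.filter fun k => W k ω - b k = W k1 ω - b k1
    have hT : T.Nonempty := ⟨k1, by simp [T]⟩
    have hmem := T.min'_mem hT
    set k := T.min' hT with hkdef
    have hkk : W k ω - b k = W k1 ω - b k1 := by simpa [T] using hmem
    refine Set.mem_iUnion.2 ⟨k, (hE _ _).2 ⟨?_, fun j => ⟨fun hj => ?_, fun hj => ?_⟩⟩, hω k⟩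
    · have := hk1 k0 (Finset.mem_univ _)
      linarith
    · refine lt_of_le_of_ne (hkk ▸ hk1 j (Finset.mem_univ _)) fun he => ?_
      have : j ∈ T := by simp [T, he, hkk]
      exact absurd (T.min'_le j this) (not_le.2 hj)
    · exact hkk ▸ hk1 j (Finset.mem_univ _)
  refine (measure_mono hcov).trans ((measure_union_le _ _).trans ?_)
  gcongr
  calc P (⋃ k, {ω | ω ∈ E k ∧ W k ω ≤ b k + t})
      ≤ ∑ k, P {ω | ω ∈ E k ∧ W k ω ≤ b k + t} := measure_iUnion_fintype_le _ _
    _ ≤ ∑ k, (ENNReal.ofReal (Real.exp (3 / 2) * (2 + L) * t) * P (E k)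
          + ENNReal.ofReal (1 / p * t)) := Finset.sum_le_sum fun k _ => hk k
    _ = ENNReal.ofReal (Real.exp (3 / 2) * (2 + L) * t) * P (⋃ k, E k)
          + p * ENNReal.ofReal (1 / p * t) := by
        rw [Finset.sum_add_distrib, ← Finset.mul_sum, measure_iUnion hdisj hEm, tsum_fintype]
        simp
    _ ≤ ENNReal.ofReal (Real.exp (3 / 2) * (2 + L) * t) * 1 + ENNReal.ofReal t := by
        gcongr
        · exact prob_le_one
        · rw [← ENNReal.ofReal_natCast, ← ENNReal.ofReal_mul (by positivity)]
          apply ENNReal.ofReal_le_ofReal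
          rw [← mul_assoc]
          rcases Nat.eq_zero_or_pos p with h | h
          · simp [h, ht]
          · rw [mul_one_div_cancel (by positivity), one_mul]
    _ = _ := by
        rw [mul_one, ← ENNReal.ofReal_add (by positivity) ht]
        congr 1; ring

lemma nazarovY {p : ℕ} (hp : 0 < p) (A : Matrix (Fin p) (Fin p) ℝ) {s : ℝ} (hs : 0 < s)
    (hsS : ∀ i, s ≤ (A * A.transpose) i i) (r : Fin p → ℝ) {h : ℝ} (hh : 0 ≤ h) :
    (_root_.stdGaussian (Fin p)).real {z | ∀ k, A.mulVec z k ≤ r k + h} ≤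
      (_root_.stdGaussian (Fin p)).real {z | ∀ k, A.mulVec z k ≤ r k} +
        29 * √(Real.log (Real.exp 1 * p)) / √s * h := by
  have hμ : IsProbabilityMeasure (_root_.stdGaussian (Fin p)) := by
    unfold _root_.stdGaussian; infer_instance
  set μ := _root_.stdGaussian (Fin p) with hμdef
  have hp1 : (1 : ℝ) ≤ p := by exact_mod_cast hp
  have hlogp : 0 ≤ Real.log p := Real.log_nonneg hp1
  have hlog : Real.log (Real.exp 1 * p) = 1 + Real.log p := by
    rw [Real.log_mul (Real.exp_pos _).ne' (by positivity), Real.log_exp]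
  set l := √(Real.log (Real.exp 1 * p)) with hl
  have hl2 : l ^ 2 = 1 + Real.log p := by rw [hl, Real.sq_sqrt (by linarith), hlog]
  have hl0 : 0 ≤ l := Real.sqrt_nonneg _
  have hl1 : 1 ≤ l := by nlinarith
  have hss : 0 < √s := Real.sqrt_pos.2 hs
  set t := h / √s with ht
  have ht0 : 0 ≤ t := by positivity
  have e29 : 29 * l / √s * h = 29 * l * t := by rw [ht]; ring
  rw [e29]
  by_cases ht1 : 1 < t
  · have h1 : μ.real {z | ∀ k, A.mulVec z k ≤ r k + h} ≤ 1 := measureReal_le_one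
    have h2 : 0 ≤ μ.real {z | ∀ k, A.mulVec z k ≤ r k} := measureReal_nonneg
    nlinarith
  push Not at ht1
  let σ : Fin p → ℝ := fun k => √((A * A.transpose) k k)
  have hσs : ∀ k, √s ≤ σ k := fun k => Real.sqrt_le_sqrt (hsS k)
  have hσ0 : ∀ k, 0 < σ k := fun k => hss.trans_le (hσs k)
  have hσ2 : ∀ k, σ k ^ 2 = ∑ j, A k j ^ 2 := by
    intro k
    rw [Real.sq_sqrt (hs.le.trans (hsS k)), Matrix.mul_apply]
    exact Finset.sum_congr rfl fun j _ => by rw [Matrix.transpose_apply]; ring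
  let W : Fin p → (Fin p → ℝ) → ℝ := fun k z => A.mulVec z k / σ k
  have hWe : ∀ k, W k = ∑ j, (fun z : Fin p → ℝ => (A k j / σ k) * z j) := by
    intro k
    ext z
    simp only [W, Matrix.mulVec, dotProduct, Finset.sum_apply, Finset.sum_div]
    exact Finset.sum_congr rfl fun j _ => by ring
  have hWm : ∀ k, Measurable (W k) := by
    intro k
    have hW' : W k = fun z => ∑ j, (A k j / σ k) * z j := by
      rw [hWe]; ext z; simp
    rw [hW']
    fun_prop
  have hid : HasGaussianLaw (fun z : Fin p → ℝ => (fun i => z i)) μ := by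
    refine iIndepFun.hasGaussianLaw (X := fun i (z : Fin p → ℝ) => z i) (fun i => ?_)
      (iIndepFun_pi (X := fun _ x => x) (fun _ => aemeasurable_id))
    refine ⟨?_⟩
    have : μ.map (fun z : Fin p → ℝ => z i) = gaussianReal 0 1 :=
      (measurePreserving_eval (fun _ : Fin p => gaussianReal 0 1) i).map_eq
    rw [this]; infer_instance
  have hW : HasGaussianLaw (fun z => (W · z)) μ := by
    let Lm : (Fin p → ℝ) →L[ℝ] (Fin p → ℝ) :=
      LinearMap.toContinuousLinearMap
      { toFun := fun x => fun k => W k x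
        map_add' := by
          intro x y; ext k; simp only [W, Matrix.mulVec_add, Pi.add_apply]; ring
        map_smul' := by
          intro c x; ext k
          simp only [W, Matrix.mulVec_smul, Pi.smul_apply, smul_eq_mul, RingHom.id_apply]; ring }
    exact hid.map_fun Lm
  have hv : ∀ k, Var[W k; μ] = 1 := by
    intro k
    rw [hWe, hμdef, _root_.stdGaussian, variance_sum_pi]
    · change ∑ i, Var[fun x ↦ _ * (id x); gaussianReal 0 1] = _
      simp_rw [variance_const_mul, variance_id_gaussianReal, div_pow]
      rw [hσ2]
      simp only [NNReal.coe_one, mul_one]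
      rw [← Finset.sum_div, div_self]
      rw [← hσ2]
      exact (pow_pos (hσ0 k) 2).ne'
    · exact fun i ↦ IsGaussian.memLp_two_id.const_mul _
  have hmean : ∀ k, ∫ z, W k z ∂μ = 0 := by
    intro k
    rw [hWe]
    simp only [Finset.sum_apply]
    rw [integral_finsetSum]
    · refine Finset.sum_eq_zero fun j _ => ?_
      rw [integral_const_mul]
      have : ∫ z : Fin p → ℝ, z j ∂μ = 0 := by
        rw [hμdef, _root_.stdGaussian]
        simp [integral_eval]
      rw [this, mul_zero]
    · intro j _
      exact (hid.eval j).integrable.const_mul _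
  have hlaw : ∀ k, μ.map (W k) = gaussianReal 0 1 := by
    intro k
    rw [(hW.eval k).map_eq_gaussianReal, hv, hmean]
    simp
  set L := √(2 * Real.log p) with hL
  have hL2 : L ^ 2 = 2 * Real.log p := Real.sq_sqrt (by linarith)
  have hL0 : 0 ≤ L := Real.sqrt_nonneg _
  have hκ : Real.exp (-(L ^ 2) / 2) ≤ 1 / p := by
    rw [hL2, show -(2 * Real.log p) / 2 = -Real.log p by ring, Real.exp_neg,
      Real.exp_log (by positivity), one_div]
  have hN := nazarov μ W hWm hW hv hlaw (fun k => r k / σ k) ht0 ht1 hL0 hκ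
  have hLl : L ≤ 3 / 2 * l := by
    apply le_of_sq_le_sq _ (by positivity)
    nlinarith
  have hexp : Real.exp (3 / 2) ≤ 8 := by
    have h1 : Real.exp (3 / 2) ≤ Real.exp 1 * Real.exp 1 := by
      rw [← Real.exp_add]; exact Real.exp_le_exp.2 (by norm_num)
    nlinarith [Real.exp_one_lt_d9, Real.exp_pos 1]
  have hc : (Real.exp (3 / 2) * (2 + L) + 1) * t ≤ 29 * l * t := by
    apply mul_le_mul_of_nonneg_right _ ht0
    nlinarith [Real.exp_pos (3 / 2)]
  have s1 : {z | ∀ k, A.mulVec z k ≤ r k + h} ⊆ {z | ∀ k, W k z ≤ r k / σ k + t} := by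
    intro z hz k
    have := hz k
    simp only [W]
    rw [div_le_iff₀ (hσ0 k), add_mul, div_mul_cancel₀ _ (hσ0 k).ne']
    have h3 : h ≤ t * σ k := by
      calc h = t * √s := by rw [ht]; field_simp
        _ ≤ _ := mul_le_mul_of_nonneg_left (hσs k) ht0
    linarith
  have s2 : {z | ∀ k, W k z ≤ r k / σ k} = {z | ∀ k, A.mulVec z k ≤ r k} := by
    ext z
    simp only [W, Set.mem_setOf_eq]
    exact forall_congr' fun k => div_le_div_iff_of_pos_right (hσ0 k)
  rw [s2] at hN
  have hN2 := (measure_mono s1).trans (hN.trans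
    (add_le_add_right (ENNReal.ofReal_le_ofReal hc) _))
  have := ENNReal.toReal_mono (by finiteness) hN2
  rw [ENNReal.toReal_add (by finiteness) (by finiteness), ENNReal.toReal_ofReal (by positivity)] at this
  exact this

lemma gauss_tail (u : ℝ) (hu : 0 ≤ u) :
    (gaussianReal 0 1).real {x | u < |x|} ≤ 2 * Real.exp (-(u ^ 2) / 2) := by
  have h1 : (gaussianReal 0 1).real {x | u ≤ id x} ≤ Real.exp (-(u ^ 2) / 2) := by
    refine (measure_ge_le_exp_mul_mgf u hu (integrable_exp_mul_gaussianReal u)).trans ?_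
    rw [mgf_fun_id_gaussianReal, ← Real.exp_add]
    apply Real.exp_le_exp.2
    simp
    nlinarith
  have h2 : (gaussianReal 0 1).real {x | id x ≤ -u} ≤ Real.exp (-(u ^ 2) / 2) := by
    refine (measure_le_le_exp_mul_mgf (t := -u) (-u) (by linarith)
      (integrable_exp_mul_gaussianReal (-u))).trans ?_
    rw [mgf_fun_id_gaussianReal, ← Real.exp_add]
    apply Real.exp_le_exp.2
    simp
    nlinarith
  have hsub : {x : ℝ | u < |x|} ⊆ {x | u ≤ id x} ∪ {x | id x ≤ -u} := by
    intro x hx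
    have hx' : u < |x| := hx
    rcases lt_abs.1 hx' with h | h
    · exact Or.inl h.le
    · right
      simp only [Set.mem_setOf_eq, id]
      linarith
  have := (measureReal_mono hsub).trans (measureReal_union_le (μ := gaussianReal 0 1) _ _)
  linarith

lemma box_prob {p : ℕ} (hp : 0 < p) :
    3 / 4 ≤ (_root_.stdGaussian (Fin p)).real
      {z | ∀ k, |z k| ≤ 3 * √(Real.log (Real.exp 1 * p))} := by
  have hμ : IsProbabilityMeasure (_root_.stdGaussian (Fin p)) := by
    unfold _root_.stdGaussian; infer_instance
  set μ := _root_.stdGaussian (Fin p) with hμdef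
  have hp1 : (1 : ℝ) ≤ p := by exact_mod_cast hp
  have hlogp : 0 ≤ Real.log p := Real.log_nonneg hp1
  have hlog : Real.log (Real.exp 1 * p) = 1 + Real.log p := by
    rw [Real.log_mul (Real.exp_pos _).ne' (by positivity), Real.log_exp]
  set l := √(Real.log (Real.exp 1 * p)) with hl
  have hl2 : l ^ 2 = 1 + Real.log p := by rw [hl, Real.sq_sqrt (by linarith), hlog]
  have hl0 : 0 ≤ l := Real.sqrt_nonneg _
  have hB : MeasurableSet {z : Fin p → ℝ | ∀ k, |z k| ≤ 3 * l} := by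
    rw [Set.setOf_forall]
    exact MeasurableSet.iInter fun k => measurableSet_le (by fun_prop) measurable_const
  have hc : μ.real {z : Fin p → ℝ | ∀ k, |z k| ≤ 3 * l}ᶜ ≤ 1 / 4 := by
    have e : {z : Fin p → ℝ | ∀ k, |z k| ≤ 3 * l}ᶜ = ⋃ k, {z | 3 * l < |z k|} := by
      ext z; simp
    rw [e]
    have hk : ∀ k : Fin p, μ.real {z | 3 * l < |z k|} ≤ 2 * Real.exp (-((3 * l) ^ 2) / 2) := by
      intro k
      have : μ.map (fun z : Fin p → ℝ => z k) = gaussianReal 0 1 :=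
        (measurePreserving_eval (fun _ : Fin p => gaussianReal 0 1) k).map_eq
      refine le_trans (le_of_eq ?_) (gauss_tail (3 * l) (by positivity))
      rw [← this, map_measureReal_apply (measurable_pi_apply k)]
      · rfl
      · exact measurableSet_lt measurable_const (by fun_prop)
    refine (measureReal_iUnion_fintype_le _).trans
      ((Finset.sum_le_sum fun k _ => hk k).trans ?_)
    rw [Finset.sum_const, Finset.card_univ, Fintype.card_fin, nsmul_eq_mul]
    have h9 : -((3 * l) ^ 2) / 2 ≤ -4 + -Real.log p := by nlinarith
    have h10 : Real.exp (-((3 * l) ^ 2) / 2) ≤ Real.exp (-4) * (p : ℝ)⁻¹ := by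
      refine (Real.exp_le_exp.2 h9).trans (le_of_eq ?_)
      rw [Real.exp_add, Real.exp_neg (Real.log p), Real.exp_log (by positivity)]
    have h11 : Real.exp (-4) ≤ 1 / 8 := by
      rw [Real.exp_neg, inv_eq_one_div]
      apply one_div_le_one_div_of_le (by norm_num)
      have : Real.exp 4 = Real.exp 1 ^ 4 := by rw [← Real.exp_nat_mul]; norm_num
      have h2 : (2 : ℝ) ≤ Real.exp 1 := by linarith [Real.exp_one_gt_d9]
      rw [this]
      calc (8 : ℝ) ≤ 2 ^ 4 := by norm_num
        _ ≤ _ := by gcongr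
    calc (p : ℝ) * (2 * Real.exp (-((3 * l) ^ 2) / 2))
        ≤ p * (2 * (1 / 8 * (p : ℝ)⁻¹)) := by
          gcongr
          exact h10.trans (by gcongr)
      _ = 1 / 4 := by field_simp; norm_num
  rw [probReal_compl_eq_one_sub hB] at hc
  linarith

lemma cell_compare {Ω : Type*} [MeasurableSpace Ω] (P : Measure Ω) [IsProbabilityMeasure P]
    {p : ℕ} (U V Z : Ω → Fin p → ℝ) (hZ : AEMeasurable Z P) (hU : IndepFun U Z P)
    (hV : IndepFun V Z P) {ε D K : ℝ} (hε : 0 < ε) (hD : 0 ≤ D) (hK : 0 ≤ K)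
    (H : ∀ r : Fin p → ℝ, ∀ h : ℝ, 0 ≤ h → P {ω | ∀ k, U ω k ≤ r k + h} ≤
      P {ω | ∀ k, V ω k ≤ r k} + ENNReal.ofReal (D + K * h))
    (r : Fin p → ℝ) (T : Set (Fin p → ℝ)) (hT : MeasurableSet T) :
    P ({ω | ∀ k, U ω k + ε * Z ω k ≤ r k} ∩ Z ⁻¹' T) ≤
      P ({ω | ∀ k, V ω k + ε * Z ω k ≤ r k} ∩ Z ⁻¹' T) + ENNReal.ofReal D * P (Z ⁻¹' T) := by
  have hIic : ∀ c : Fin p → ℝ, MeasurableSet {x : Fin p → ℝ | ∀ k, x k ≤ c k} := fun c => by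
    rw [Set.setOf_forall]
    exact MeasurableSet.iInter fun k => measurableSet_le (by fun_prop) measurable_const
  have hUi : ∀ (c : Fin p → ℝ) (T' : Set (Fin p → ℝ)), MeasurableSet T' →
      P ({ω | ∀ k, U ω k ≤ c k} ∩ Z ⁻¹' T') = P {ω | ∀ k, U ω k ≤ c k} * P (Z ⁻¹' T') :=
    fun c T' hT' => hU.measure_inter_preimage_eq_mul _ _ (hIic c) hT'
  have hVi : ∀ (c : Fin p → ℝ) (T' : Set (Fin p → ℝ)), MeasurableSet T' →
      P ({ω | ∀ k, V ω k ≤ c k} ∩ Z ⁻¹' T') = P {ω | ∀ k, V ω k ≤ c k} * P (Z ⁻¹' T') :=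
    fun c T' hT' => hV.measure_inter_preimage_eq_mul _ _ (hIic c) hT'
  have main : ∀ η : ℝ, 0 < η → P ({ω | ∀ k, U ω k + ε * Z ω k ≤ r k} ∩ Z ⁻¹' T) ≤
      P ({ω | ∀ k, V ω k + ε * Z ω k ≤ r k} ∩ Z ⁻¹' T) +
        ENNReal.ofReal (D + K * (ε * η)) * P (Z ⁻¹' T) := by
    intro η hη
    let Q : (Fin p → ℤ) → Set (Fin p → ℝ) := fun n => {z | (fun k => ⌊z k / η⌋) = n}
    have hQm : ∀ n, MeasurableSet (Q n) := by
      intro n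
      have : Measurable fun z : Fin p → ℝ => (fun k => ⌊z k / η⌋) :=
        measurable_pi_lambda _ fun k => Int.measurable_floor.comp (by fun_prop)
      exact this (measurableSet_singleton n)
    have hsplit : ∀ A : Set Ω, P (A ∩ Z ⁻¹' T) = ∑' n, P (A ∩ Z ⁻¹' (T ∩ Q n)) := by
      intro A
      have hmap : ∀ T', MeasurableSet T' → (P.restrict A).map Z T' = P (A ∩ Z ⁻¹' T') := by
        intro T' hT'
        rw [Measure.map_apply_of_aemeasurable hZ.restrict hT',
          Measure.restrict_apply₀ (hZ.restrict.nullMeasurableSet_preimage hT'), Set.inter_comm]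
      rw [← hmap T hT]
      simp_rw [← fun n => hmap _ (hT.inter (hQm n))]
      rw [← measure_iUnion]
      · congr 1
        ext z
        simp [Q]
      · intro i j hij
        rw [Function.onFun, Set.disjoint_left]
        rintro z ⟨-, hi⟩ ⟨-, hj⟩
        exact hij (hi.symm.trans hj)
      · exact fun n => hT.inter (hQm n)
    have hone := hsplit Set.univ
    simp only [Set.univ_inter] at hone
    rw [hsplit, hsplit, hone, ← ENNReal.tsum_mul_left, ← ENNReal.tsum_add]
    refine ENNReal.tsum_le_tsum fun n => ?_
    have hTn := hT.inter (hQm n)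
    have hlo : ∀ z ∈ Q n, ∀ k, η * n k ≤ z k ∧ z k ≤ η * n k + η := by
      intro z hz k
      have hk : ⌊z k / η⌋ = n k := congrFun hz k
      have h1 := Int.floor_le (z k / η)
      have h2 := (Int.lt_floor_add_one (z k / η)).le
      rw [hk] at h1 h2
      rw [le_div_iff₀ hη] at h1
      rw [div_le_iff₀ hη] at h2
      constructor <;> linarith
    let c : Fin p → ℝ := fun k => r k - ε * (η * n k + η)
    calc P ({ω | ∀ k, U ω k + ε * Z ω k ≤ r k} ∩ Z ⁻¹' (T ∩ Q n))
        ≤ P ({ω | ∀ k, U ω k ≤ c k + ε * η} ∩ Z ⁻¹' (T ∩ Q n)) := by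
          apply measure_mono
          rintro ω ⟨h1, h2⟩
          refine ⟨fun k => ?_, h2⟩
          have := mul_le_mul_of_nonneg_left (hlo _ h2.2 k).1 hε.le
          have h3 := h1 k
          simp only [c]
          nlinarith
      _ = P {ω | ∀ k, U ω k ≤ c k + ε * η} * P (Z ⁻¹' (T ∩ Q n)) := hUi _ _ hTn
      _ ≤ (P {ω | ∀ k, V ω k ≤ c k} + ENNReal.ofReal (D + K * (ε * η))) *
            P (Z ⁻¹' (T ∩ Q n)) := by
          gcongr
          exact H c (ε * η) (by positivity)
      _ = P ({ω | ∀ k, V ω k ≤ c k} ∩ Z ⁻¹' (T ∩ Q n)) +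
            ENNReal.ofReal (D + K * (ε * η)) * P (Z ⁻¹' (T ∩ Q n)) := by
          rw [add_mul, hVi _ _ hTn]
      _ ≤ _ := by
          gcongr ?_ + _
          apply measure_mono
          rintro ω ⟨h1, h2⟩
          refine ⟨fun k => ?_, h2⟩
          have := mul_le_mul_of_nonneg_left (hlo _ h2.2 k).2 hε.le
          have h3 := h1 k
          simp only [c] at h3
          linarith
  refine ENNReal.le_of_forall_pos_le_add fun e he _ => ?_
  have he' : (0 : ℝ) < e := he
  refine (main (e / (ε * (K + 1))) (by positivity)).trans ?_
  rw [add_assoc]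
  gcongr
  rw [ENNReal.ofReal_add hD (by positivity), add_mul]
  gcongr
  calc ENNReal.ofReal (K * (ε * (e / (ε * (K + 1))))) * P (Z ⁻¹' T)
      ≤ ENNReal.ofReal e * 1 := by
        gcongr
        · have : K * (ε * (e / (ε * (K + 1)))) = K / (K + 1) * e := by field_simp
          rw [this]
          have : K / (K + 1) ≤ 1 := by rw [div_le_one (by positivity)]; linarith
          nlinarith
        · exact prob_le_one
    _ = e := by simp

lemma smooth_step {Ω : Type*} [MeasurableSpace Ω] (P : Measure Ω) [IsProbabilityMeasure P]
    {p : ℕ} (U V Z : Ω → Fin p → ℝ) (hZ : AEMeasurable Z P) (hU : IndepFun U Z P)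
    (hV : IndepFun V Z P) {ε D K M u : ℝ} (hε : 0 < ε) (hD : 0 ≤ D) (hK : 0 ≤ K)
    (H : ∀ r : Fin p → ℝ, ∀ h : ℝ, 0 ≤ h → P.real {ω | ∀ k, V ω k ≤ r k + h} ≤
      P.real {ω | ∀ k, U ω k ≤ r k} + (D + K * h))
    (hM : ∀ r : Fin p → ℝ, P.real {ω | ∀ k, U ω k + ε * Z ω k ≤ r k} ≤
      P.real {ω | ∀ k, V ω k + ε * Z ω k ≤ r k} + M)
    (r : Fin p → ℝ) :
    P.real (Z ⁻¹' {z | ∀ k, |z k| ≤ u}) * P.real {ω | ∀ k, U ω k ≤ r k} ≤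
      P.real (Z ⁻¹' {z | ∀ k, |z k| ≤ u}) * P.real {ω | ∀ k, V ω k ≤ r k + 2 * (ε * u)} + M +
        D * (1 - P.real (Z ⁻¹' {z | ∀ k, |z k| ≤ u})) := by
  have hIic : ∀ c : Fin p → ℝ, MeasurableSet {x : Fin p → ℝ | ∀ k, x k ≤ c k} := fun c => by
    rw [Set.setOf_forall]
    exact MeasurableSet.iInter fun k => measurableSet_le (by fun_prop) measurable_const
  set B : Set (Fin p → ℝ) := {z | ∀ k, |z k| ≤ u} with hBdef
  have hB : MeasurableSet B := by
    rw [hBdef, Set.setOf_forall]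
    exact MeasurableSet.iInter fun k => measurableSet_le (by fun_prop) measurable_const
  have hZB : NullMeasurableSet (Z ⁻¹' B) P := hZ.nullMeasurableSet_preimage hB
  have split : ∀ A : Set Ω, P.real (A ∩ Z ⁻¹' B) + P.real (A ∩ Z ⁻¹' Bᶜ) = P.real A := by
    intro A
    have h := measure_inter_add_diff₀ A hZB
    rw [Set.diff_eq, ← Set.preimage_compl] at h
    rw [measureReal_def, measureReal_def, measureReal_def,
      ← ENNReal.toReal_add (by finiteness) (by finiteness), h]
  let r' : Fin p → ℝ := fun k => r k + ε * u
  have hcell := cell_compare P V U Z hZ hV hU hε hD hK (by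
    intro r h hh
    have h0 : 0 ≤ D + K * h := by positivity
    rw [← ENNReal.toReal_le_toReal (by finiteness) (by finiteness),
      ENNReal.toReal_add (by finiteness) (by finiteness), ENNReal.toReal_ofReal h0]
    exact H r h hh) r' Bᶜ hB.compl
  have hcell' : P.real ({ω | ∀ k, V ω k + ε * Z ω k ≤ r' k} ∩ Z ⁻¹' Bᶜ) ≤
      P.real ({ω | ∀ k, U ω k + ε * Z ω k ≤ r' k} ∩ Z ⁻¹' Bᶜ) + D * P.real (Z ⁻¹' Bᶜ) := by
    rw [← ENNReal.toReal_le_toReal (by finiteness) (by finiteness),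
      ENNReal.toReal_add (by finiteness) (by finiteness), ENNReal.toReal_mul,
      ENNReal.toReal_ofReal hD] at hcell
    exact hcell
  have hq : P.real (Z ⁻¹' Bᶜ) = 1 - P.real (Z ⁻¹' B) := by
    have := split Set.univ
    simp only [Set.univ_inter, probReal_univ] at this
    linarith
  rw [hq] at hcell'
  have hbd : ∀ ω, ω ∈ Z ⁻¹' B → ∀ k, ε * Z ω k ≤ ε * u ∧ -(ε * u) ≤ ε * Z ω k := by
    intro ω hω k
    have := abs_le.1 (hω k)
    exact ⟨mul_le_mul_of_nonneg_left this.2 hε.le, by nlinarith [this.1]⟩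
  have h1 : P.real (Z ⁻¹' B) * P.real {ω | ∀ k, U ω k ≤ r k} ≤
      P.real ({ω | ∀ k, U ω k + ε * Z ω k ≤ r' k} ∩ Z ⁻¹' B) := by
    have e : P ({ω | ∀ k, U ω k ≤ r k} ∩ Z ⁻¹' B) = _ :=
      hU.measure_inter_preimage_eq_mul _ _ (hIic r) hB
    have e' := congrArg ENNReal.toReal e
    rw [ENNReal.toReal_mul] at e'
    refine le_trans (le_of_eq ((mul_comm _ _).trans e'.symm)) (measureReal_mono ?_)
    rintro ω ⟨ha, hb⟩
    refine ⟨fun k => ?_, hb⟩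
    have := (hbd ω hb k).1
    have := ha k
    simp only [r']
    linarith
  have h2 : P.real ({ω | ∀ k, V ω k + ε * Z ω k ≤ r' k} ∩ Z ⁻¹' B) ≤
      P.real (Z ⁻¹' B) * P.real {ω | ∀ k, V ω k ≤ r k + 2 * (ε * u)} := by
    have e : P ({ω | ∀ k, V ω k ≤ r k + 2 * (ε * u)} ∩ Z ⁻¹' B) = _ :=
      hV.measure_inter_preimage_eq_mul _ _ (hIic fun k => r k + 2 * (ε * u)) hB
    have e' := congrArg ENNReal.toReal e
    rw [ENNReal.toReal_mul] at e'
    refine le_trans (measureReal_mono ?_) (le_of_eq (e'.trans (mul_comm _ _)))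
    rintro ω ⟨ha, hb⟩
    refine ⟨fun k => ?_, hb⟩
    have := (hbd ω hb k).2
    have := ha k
    simp only [r'] at this
    linarith
  have h3 := split {ω | ∀ k, U ω k + ε * Z ω k ≤ r' k}
  have h4 := split {ω | ∀ k, V ω k + ε * Z ω k ≤ r' k}
  have h5 := hM r'
  linarith

lemma kdist_le {Ω : Type*} [MeasurableSpace Ω] (P : Measure Ω) [IsProbabilityMeasure P] {p : ℕ}
    (U V : Ω → Fin p → ℝ) (r : Fin p → ℝ) :
    |P.real {ω | ∀ k, U ω k ≤ r k} - P.real {ω | ∀ k, V ω k ≤ r k}| ≤ kdist P U V := by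
  refine le_ciSup (f := fun r : Fin p → ℝ =>
    |(P {ω | ∀ k, U ω k ≤ r k}).toReal - (P {ω | ∀ k, V ω k ≤ r k}).toReal|) ⟨1, ?_⟩ r
  rintro _ ⟨r, rfl⟩
  have h1 : P.real {ω | ∀ k, U ω k ≤ r k} ≤ 1 := measureReal_le_one
  have h2 : P.real {ω | ∀ k, V ω k ≤ r k} ≤ 1 := measureReal_le_one
  have h3 : 0 ≤ P.real {ω | ∀ k, U ω k ≤ r k} := measureReal_nonneg
  have h4 : 0 ≤ P.real {ω | ∀ k, V ω k ≤ r k} := measureReal_nonneg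
  rw [measureReal_def] at h1 h2 h3 h4
  exact abs_le.2 ⟨by linarith, by linarith⟩

theorem stmt2 :
    ∃ C : ℝ, 0 < C ∧
      ∀ (p : ℕ), 0 < p →
      ∀ (Ω : Type) [MeasurableSpace Ω] (P : Measure Ω) [IsProbabilityMeasure P]
        (X Y Z : Ω → Fin p → ℝ) (S : Matrix (Fin p) (Fin p) ℝ),
        IsCenteredGaussianLaw P Y S → (∀ i, 0 < S i i) →
        Measure.map Z P = stdGaussian (Fin p) →
        IndepFun X Z P → IndepFun Y Z P →
        ∀ ε : ℝ, 0 < ε →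
          kdist P X Y ≤
            C * kdist P (fun ω k => X ω k + ε * Z ω k) (fun ω k => Y ω k + ε * Z ω k)
              + C * ε * Real.log (Real.exp 1 * p) / Real.sqrt (⨅ i, S i i) := by

  refine ⟨4 * (3 * 29), by norm_num, ?_⟩
  intro p hp Ω _ P _ X Y Z S hY hS hZlaw hXZ hYZ ε hε
  obtain ⟨A, hSA, hYlaw⟩ := hY
  have : Nonempty (Fin p) := ⟨⟨0, hp⟩⟩
  set s := ⨅ i, S i i with hs
  have hs0 : 0 < s := by
    obtain ⟨i, hi⟩ := exists_eq_ciInf_of_finite (f := fun i => S i i)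
    rw [hs, ← hi]; exact hS i
  have hsS : ∀ i, s ≤ (A * A.transpose) i i := fun i => by
    rw [← hSA]; exact ciInf_le (Set.finite_range _).bddBelow i
  have hμ : IsProbabilityMeasure (_root_.stdGaussian (Fin p)) := by
    unfold _root_.stdGaussian; infer_instance
  have hAm : Measurable fun z : Fin p → ℝ => A.mulVec z := by fun_prop
  have hZ : AEMeasurable Z P := by
    by_contra h
    rw [Measure.map_of_not_aemeasurable h] at hZlaw
    exact IsProbabilityMeasure.ne_zero (_root_.stdGaussian (Fin p)) hZlaw.symm
  have hYm : AEMeasurable Y P := by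
    by_contra h
    rw [Measure.map_of_not_aemeasurable h] at hYlaw
    have := Measure.isProbabilityMeasure_map (μ := _root_.stdGaussian (Fin p)) hAm.aemeasurable
    exact IsProbabilityMeasure.ne_zero _ hYlaw.symm
  have hIic : ∀ c : Fin p → ℝ, MeasurableSet {x : Fin p → ℝ | ∀ k, x k ≤ c k} := fun c => by
    rw [Set.setOf_forall]
    exact MeasurableSet.iInter fun k => measurableSet_le (by fun_prop) measurable_const
  have hFY : ∀ c : Fin p → ℝ, P.real {ω | ∀ k, Y ω k ≤ c k} =
      (_root_.stdGaussian (Fin p)).real {z | ∀ k, A.mulVec z k ≤ c k} := by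
    intro c
    have h := congrArg (fun m => m {x : Fin p → ℝ | ∀ k, x k ≤ c k}) hYlaw
    beta_reduce at h
    rw [Measure.map_apply_of_aemeasurable hYm (hIic c), Measure.map_apply hAm (hIic c)] at h
    exact congrArg ENNReal.toReal h
  set ℓ := √(Real.log (Real.exp 1 * p)) with hℓ
  have hp1 : (1 : ℝ) ≤ p := by exact_mod_cast hp
  have hlogp : 0 ≤ Real.log p := Real.log_nonneg hp1
  have hlog : Real.log (Real.exp 1 * p) = 1 + Real.log p := by
    rw [Real.log_mul (Real.exp_pos _).ne' (by positivity), Real.log_exp]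
  have hℓ2 : ℓ ^ 2 = Real.log (Real.exp 1 * p) := Real.sq_sqrt (by linarith)
  have hℓ0 : 0 ≤ ℓ := Real.sqrt_nonneg _
  set K := 29 * ℓ / √s with hKdef
  have hss : 0 < √s := Real.sqrt_pos.2 hs0
  have hK : 0 ≤ K := by positivity
  have hlip : ∀ (r : Fin p → ℝ) (h : ℝ), 0 ≤ h →
      P.real {ω | ∀ k, Y ω k ≤ r k + h} ≤ P.real {ω | ∀ k, Y ω k ≤ r k} + K * h := by
    intro r h hh
    rw [hFY (fun k => r k + h), hFY r]
    exact nazarovY hp A hs0 hsS r hh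
  have hq : 3 / 4 ≤ P.real (Z ⁻¹' {z | ∀ k, |z k| ≤ 3 * ℓ}) := by
    have hB : MeasurableSet {z : Fin p → ℝ | ∀ k, |z k| ≤ 3 * ℓ} := by
      rw [Set.setOf_forall]
      exact MeasurableSet.iInter fun k => measurableSet_le (by fun_prop) measurable_const
    have h := box_prob hp
    rw [← hZlaw, measureReal_def, Measure.map_apply_of_aemeasurable hZ hB] at h
    exact h
  have hq1 : P.real (Z ⁻¹' {z | ∀ k, |z k| ≤ 3 * ℓ}) ≤ 1 := measureReal_le_one
  set q := P.real (Z ⁻¹' {z | ∀ k, |z k| ≤ 3 * ℓ}) with hqdef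
  set D := kdist P X Y with hDdef
  set M := kdist P (fun ω k => X ω k + ε * Z ω k) (fun ω k => Y ω k + ε * Z ω k) with hMdef
  have hDr : ∀ r : Fin p → ℝ,
      |P.real {ω | ∀ k, X ω k ≤ r k} - P.real {ω | ∀ k, Y ω k ≤ r k}| ≤ D := kdist_le P X Y
  have hMr : ∀ r : Fin p → ℝ, |P.real {ω | ∀ k, X ω k + ε * Z ω k ≤ r k} -
      P.real {ω | ∀ k, Y ω k + ε * Z ω k ≤ r k}| ≤ M :=
    kdist_le P (fun ω k => X ω k + ε * Z ω k) (fun ω k => Y ω k + ε * Z ω k)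
  have hD0 : 0 ≤ D := (abs_nonneg _).trans (hDr 0)
  have hM0 : 0 ≤ M := (abs_nonneg _).trans (hMr 0)
  have hδ : 0 ≤ 2 * (ε * (3 * ℓ)) := by positivity
  have key : ∀ r : Fin p → ℝ,
      |P.real {ω | ∀ k, X ω k ≤ r k} - P.real {ω | ∀ k, Y ω k ≤ r k}| ≤
      (K * (2 * (ε * (3 * ℓ)))) + (M + D * (1 - q)) / q := by
    intro r
    have hXY := smooth_step P X Y Z hZ hXZ hYZ (u := 3 * ℓ) (M := M) hε hD0 hK
      (fun r h hh => by
        have h1 := hlip r h hh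
        have h2 := (abs_le.1 (hDr r)).1
        linarith)
      (fun r => by
        have h2 := (abs_le.1 (hMr r)).2
        linarith) r
    have hYX := smooth_step P Y X Z hZ hYZ hXZ (u := 3 * ℓ) (M := M) hε hD0 hK
      (fun r h hh => by
        have h1 := hlip r h hh
        have h2 := (abs_le.1 (hDr fun k => r k + h)).2
        linarith)
      (fun r => by
        have h2 := (abs_le.1 (hMr r)).1
        linarith) (fun k => r k - 2 * (ε * (3 * ℓ)))
    have l1 := hlip r _ hδ
    have l2 := hlip (fun k => r k - 2 * (ε * (3 * ℓ))) _ hδ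
    simp only [sub_add_cancel] at hYX l2
    rw [← hqdef] at hXY hYX
    have hq0 : 0 < q := by linarith
    have e1 : (M + D * (1 - q)) / q * q = M + D * (1 - q) := div_mul_cancel₀ _ hq0.ne'
    have m1 := mul_le_mul_of_nonneg_left l1 hq0.le
    have m2 := mul_le_mul_of_nonneg_left l2 hq0.le
    refine abs_le.2 ⟨?_, ?_⟩
    · refine le_of_mul_le_mul_left ?_ hq0
      linarith
    · refine le_of_mul_le_mul_left ?_ hq0
      linarith
  have hDle : D ≤ (K * (2 * (ε * (3 * ℓ)))) + (M + D * (1 - q)) / q := ciSup_le key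
  have hdiv : (M + D * (1 - q)) / q ≤ (4 / 3) * M + (1 / 3) * D := by
    rw [div_le_iff₀ (by linarith)]
    nlinarith
  have e : 4 * (3 * 29) * ε * Real.log (Real.exp 1 * p) / √s
      = 2 * (K * (2 * (ε * (3 * ℓ)))) := by
    rw [← hℓ2, hKdef]; ring
  rw [e]
  have : 0 ≤ K * (2 * (ε * (3 * ℓ))) := by positivity
  nlinarith
end

section
/- Let φ_{r,ε}(x) = P[x + εZ ≤ r] with Z standard Gaussian in R^p, and let δ = c·ε·sqrt(log(pn)) for a suitable absolute constant c > 0. Then for all x ∈ R^p, ‖∇³φ_{r,ε}(x)‖_1 ≤ C·(1/(ε³ p n) + (log(ep))^{3/2}/ε³ · 1{x ∈ A_{r,δ}}), i.e., away from a slab of width δ around the boundary {x : max_k (x_k − r_k) = 0} the third derivatives are negligible, of size at most C/(ε³ pn). -/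
open MeasureTheory ProbabilityTheory Real
open scoped Classical

/-- `φ_{r,ε}(x) = P[x + εZ ≤ r]` for `Z` standard Gaussian in `ℝ^p`. -/
noncomputable def phi (p : ℕ) (r : Fin p → ℝ) (ε : ℝ) (x : Fin p → ℝ) : ℝ :=
  ((stdGaussian (Fin p)) {z | ∀ k, x k + ε * z k ≤ r k}).toReal


noncomputable def gf (t : ℝ) : ℝ := gaussianPDFReal 0 1 t

noncomputable def gPhi (t : ℝ) : ℝ := ∫ y in Set.Iic t, gf y

lemma gf_eq (t : ℝ) : gf t = (√(2 * π))⁻¹ * Real.exp (-t ^ 2 / 2) := by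
  simp [gf, gaussianPDFReal]

lemma gf_pos (t : ℝ) : 0 < gf t := by
  unfold gf; exact gaussianPDFReal_pos 0 1 t (by simp)

lemma gf_contDiff : ContDiff ℝ ⊤ gf := by
  have : gf = fun t : ℝ => (√(2 * π))⁻¹ * Real.exp (-t ^ 2 / 2) := funext gf_eq
  rw [this]; fun_prop

lemma gf_integrable : Integrable gf := integrable_gaussianPDFReal 0 1

lemma gf_integral : ∫ t, gf t = 1 := integral_gaussianPDFReal_eq_one 0 (by simp)

lemma gf_le (t : ℝ) : gf t ≤ Real.exp (-t ^ 2 / 2) := by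
  rw [gf_eq]
  have h : (√(2 * π))⁻¹ ≤ 1 := by
    apply inv_le_one_of_one_le₀
    rw [Real.one_le_sqrt]
    nlinarith [Real.pi_gt_three]
  exact mul_le_of_le_one_left (Real.exp_pos _).le h

lemma gf_neg (t : ℝ) : gf (-t) = gf t := by simp [gf_eq]

lemma gPhi_hasDeriv (t : ℝ) : HasDerivAt gPhi (gf t) t := by
  have h : gPhi = fun t => gPhi 0 + ∫ y in (0:ℝ)..t, gf y := by
    funext t
    unfold gPhi
    rw [← intervalIntegral.integral_Iic_sub_Iic gf_integrable.integrableOn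
      gf_integrable.integrableOn]
    ring
  rw [h]
  refine HasDerivAt.const_add _ ?_
  exact intervalIntegral.integral_hasDerivAt_right gf_integrable.intervalIntegrable
    (gf_contDiff.continuous.stronglyMeasurableAtFilter _ _) gf_contDiff.continuous.continuousAt

lemma gPhi_deriv : deriv gPhi = gf := funext fun t => (gPhi_hasDeriv t).deriv

lemma gPhi_contDiff : ContDiff ℝ 3 gPhi := by
  have : (3 : WithTop ℕ∞) = 2 + 1 := by norm_num
  rw [this, contDiff_succ_iff_deriv]
  refine ⟨fun t => (gPhi_hasDeriv t).differentiableAt, by simp, ?_⟩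
  rw [gPhi_deriv]; exact gf_contDiff.of_le le_top

lemma gPhi_add_neg (t : ℝ) : gPhi t + gPhi (-t) = 1 := by
  unfold gPhi
  have h := integral_comp_neg_Iic (-t) gf
  simp only [gf_neg, neg_neg] at h
  rw [h, ← gf_integral, intervalIntegral.integral_Iic_add_Ioi gf_integrable.integrableOn
      gf_integrable.integrableOn]

lemma gPhi_mono : Monotone gPhi := by
  apply monotone_of_deriv_nonneg (fun t => (gPhi_hasDeriv t).differentiableAt)
  intro t; rw [gPhi_deriv]; exact (gf_pos t).le

lemma gPhi_lower (t : ℝ) : Real.exp (-3/2) * gf t / (1 + |t|) ≤ gPhi t := by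
  set s := 1 / (1 + |t|) with hs
  have hat := abs_nonneg t
  have hs0 : 0 < s := by positivity
  have hs1 : s ≤ 1 := by rw [hs, div_le_one (by positivity)]; linarith
  have hst : |t| * s ≤ 1 := by
    rw [hs, mul_one_div, div_le_one (by positivity)]; linarith
  have h1 : ∫ y in Set.Ioc (t - s) t, gf y ≤ gPhi t := by
    unfold gPhi
    apply setIntegral_mono_set gf_integrable.integrableOn
    · exact Filter.Eventually.of_forall fun y => (gf_pos y).le
    · exact Filter.Eventually.of_forall fun y hy => hy.2
  have h2 : ∫ y in Set.Ioc (t - s) t, (Real.exp (-3/2) * gf t) ≤ ∫ y in Set.Ioc (t - s) t, gf y := by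
    apply setIntegral_mono_on _ gf_integrable.integrableOn measurableSet_Ioc
    · intro y hy
      rw [gf_eq, gf_eq, mul_left_comm, ← Real.exp_add]
      apply mul_le_mul_of_nonneg_left _ (by positivity)
      apply Real.exp_le_exp.2
      have hy' : |y| ≤ |t| + s := by
        have : |y| ≤ |t| + |y - t| := by
          have := abs_add_le t (y - t); simpa using this
        have h3 : |y - t| ≤ s := by rw [abs_le]; constructor <;> linarith [hy.1, hy.2]
        linarith
      have : y ^ 2 ≤ (|t| + s) ^ 2 := by
        rw [← sq_abs y]; exact pow_le_pow_left₀ (abs_nonneg _) hy' 2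
      have := sq_abs t
      nlinarith
    · exact continuous_const.integrableOn_Ioc
  refine le_trans ?_ (h2.trans h1)
  simp [hs0.le]
  rw [hs]
  apply le_of_eq; field_simp

lemma gPhi_pos (t : ℝ) : 0 < gPhi t :=
  lt_of_lt_of_le (by have := gf_pos t; positivity) (gPhi_lower t)

lemma gPhi_le_one (t : ℝ) : gPhi t ≤ 1 := by
  linarith [gPhi_add_neg t, gPhi_pos (-t)]

lemma gPhi_upper {t : ℝ} (ht : t ≤ 0) : gPhi t ≤ Real.exp (-t ^ 2 / 2) := by
  have hi : Integrable fun y => Real.exp (-t ^ 2 / 2) * gf (y - t) :=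
    (gf_integrable.comp_sub_right t).const_mul _
  calc gPhi t ≤ ∫ y in Set.Iic t, Real.exp (-t ^ 2 / 2) * gf (y - t) := by
        unfold gPhi
        apply setIntegral_mono_on gf_integrable.integrableOn hi.integrableOn measurableSet_Iic
        intro y hy
        rw [gf_eq, gf_eq, mul_left_comm, ← Real.exp_add]
        apply mul_le_mul_of_nonneg_left _ (by positivity)
        apply Real.exp_le_exp.2
        have : y ≤ t := hy
        nlinarith
    _ ≤ ∫ y, Real.exp (-t ^ 2 / 2) * gf (y - t) := by
        apply setIntegral_le_integral hi
        exact Filter.Eventually.of_forall fun y => by have := gf_pos (y - t); positivity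
    _ = _ := by
        rw [integral_const_mul, integral_sub_right_eq_self gf t, gf_integral, mul_one]

noncomputable def ga (t : ℝ) : ℝ := -Real.log (gPhi t)

lemma ga_nonneg (t : ℝ) : 0 ≤ ga t := by
  unfold ga; linarith [Real.log_nonpos (gPhi_pos t).le (gPhi_le_one t)]

lemma exp_ga (t : ℝ) : Real.exp (-ga t) = gPhi t := by
  unfold ga; rw [neg_neg, Real.exp_log (gPhi_pos t)]

lemma ga_ge (t : ℝ) : gPhi (-t) ≤ ga t := by
  unfold ga; linarith [Real.log_le_sub_one_of_pos (gPhi_pos t), gPhi_add_neg t]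

lemma ga_ge_sq {t : ℝ} (ht : t ≤ 0) : t ^ 2 / 2 ≤ ga t := by
  have := Real.log_le_log (gPhi_pos t) (gPhi_upper ht)
  rw [Real.log_exp] at this
  unfold ga; linarith

lemma key2 {t : ℝ} (ht : 0 ≤ t) {j : ℕ} (hj : j ≤ 2) :
    (1 + |t|) ^ j * (gf t / gPhi t) ≤ 8 / gPhi 0 * Real.exp (-t ^ 2 / 4) := by
  have h0 := gPhi_pos 0
  have h1 : gf t / gPhi t ≤ Real.exp (-t ^ 2 / 2) / gPhi 0 := by
    have := gPhi_mono ht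
    have := gf_le t
    gcongr
  have h2 : (1 + |t|) ^ j ≤ 8 * Real.exp (t ^ 2 / 4) := by
    calc (1 + |t|) ^ j ≤ (1 + |t|) ^ 2 := pow_le_pow_right₀ (by linarith [abs_nonneg t]) hj
      _ ≤ 8 * (t ^ 2 / 4 + 1) := by rw [abs_of_nonneg ht]; nlinarith [sq_nonneg (t - 1)]
      _ ≤ _ := by gcongr; exact Real.add_one_le_exp _
  have h3 : Real.exp (-t ^ 2 / 2) = Real.exp (-t ^ 2 / 4) * Real.exp (-t ^ 2 / 4) := by
    rw [← Real.exp_add]; ring_nf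
  have h4 : Real.exp (t ^ 2 / 4) * Real.exp (-t ^ 2 / 4) = 1 := by
    rw [← Real.exp_add]; ring_nf; simp
  calc _ ≤ (8 * Real.exp (t ^ 2 / 4)) * (Real.exp (-t ^ 2 / 2) / gPhi 0) := by
        apply mul_le_mul h2 h1 _ (by positivity)
        have := gf_pos t; have := gPhi_pos t; positivity
    _ = 8 / gPhi 0 * (Real.exp (t ^ 2 / 4) * Real.exp (-t ^ 2 / 4)) * Real.exp (-t ^ 2 / 4) := by
        rw [h3]; ring
    _ = _ := by rw [h4]; ring

lemma key1 : ∃ K : ℝ, 1 ≤ K ∧ ∀ (s t : ℝ) (j : ℕ), 1 ≤ s → j ≤ 2 →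
    (1 + |t|) ^ j * (gf t / gPhi t) ≤
      K * (Real.exp (-s ^ 2) + s ^ (j + 1) * (ga t + ga t ^ 2)) := by
  set c0 := gPhi 0 with hc0
  set M := Real.exp (3/2) with hM
  have h0 : 0 < c0 := gPhi_pos 0
  have hM0 : 0 < M := Real.exp_pos _
  have hMM : Real.exp (-3/2) = M⁻¹ := by rw [hM, ← Real.exp_neg]; ring_nf
  refine ⟨1 + 8 / c0 + 27 * M / c0 + M * (32 + 8 / c0), by
    have : 0 < 8 / c0 + 27 * M / c0 + M * (32 + 8 / c0) := by positivity
    linarith, ?_⟩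
  intro s t j hs hj
  have hga := ga_nonneg t
  have hE := Real.exp_pos (-s ^ 2)
  have hgf := gf_pos t
  have hgP := gPhi_pos t
  have hsj : 1 ≤ s ^ (j + 1) := one_le_pow₀ hs
  have habs := abs_nonneg t
  set X := ga t + ga t ^ 2 with hX
  have hX0 : 0 ≤ X := by positivity
  have hXs : X ≤ s ^ (j + 1) * X := le_mul_of_one_le_left hX0 hsj
  have fin : ∀ k E Y : ℝ, 0 ≤ k → k ≤ 1 + 8 / c0 + 27 * M / c0 + M * (32 + 8 / c0) →
      0 ≤ Y → Y ≤ Real.exp (-s ^ 2) + s ^ (j + 1) * X →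
      k * Y ≤ (1 + 8 / c0 + 27 * M / c0 + M * (32 + 8 / c0)) *
        (Real.exp (-s ^ 2) + s ^ (j + 1) * X) := by
    intro k E Y hk hk' hY hY'
    exact mul_le_mul hk' hY' hY (hk.trans hk')
  have p1 : 0 < 8 / c0 := by positivity
  have p2 : 0 < 27 * M / c0 := by positivity
  have p3 : 0 < M * (32 + 8 / c0) := by positivity
  have hsX : 0 ≤ s ^ (j + 1) * X := by positivity
  rcases le_or_gt t 0 with ht | ht
  · have h1 : gf t / gPhi t ≤ M * (1 + |t|) := by
      have := gPhi_lower t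
      rw [hMM] at this
      rw [div_le_iff₀ hgP]
      rw [div_le_iff₀ (by positivity), inv_mul_le_iff₀ hM0] at this
      linarith
    have h2 : (1 + |t|) ^ j * (gf t / gPhi t) ≤ M * (1 + |t|) ^ 4 := by
      calc _ ≤ (1 + |t|) ^ j * (M * (1 + |t|)) := by gcongr
        _ = M * (1 + |t|) ^ (j + 1) := by ring
        _ ≤ _ := by
          gcongr
          · linarith
          · omega
    have h3 : (1 + |t|) ^ 4 ≤ 8 + 8 * t ^ 4 := by
      have : t ^ 4 = |t| ^ 4 := by rw [← abs_pow]; symm; apply abs_of_nonneg; positivity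
      rw [this]
      have e1 : (1 + |t|)^2 ≤ 2 * (1 + |t|^2) := by nlinarith [sq_nonneg (1 - |t|)]
      have e2 : ((1 + |t|)^2)^2 ≤ (2 * (1 + |t|^2))^2 := pow_le_pow_left₀ (by positivity) e1 2
      nlinarith [sq_nonneg (1 - |t|^2)]
    have h4 : t ^ 4 ≤ 4 * ga t ^ 2 := by
      have := pow_le_pow_left₀ (by positivity) (ga_ge_sq ht) 2
      nlinarith
    have h5 : 1 ≤ ga t / c0 := by
      rw [one_le_div h0]
      exact (gPhi_mono (by linarith)).trans (ga_ge t)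
    have h6 : (1 + |t|) ^ 4 ≤ (32 + 8 / c0) * X := by
      have : (32 + 8 / c0) * X = 32 * ga t + 32 * ga t ^ 2 + 8 * (ga t / c0) + 8 / c0 * ga t ^ 2 := by
        rw [hX]; ring
      have : 0 ≤ 8 / c0 * ga t ^ 2 := by positivity
      linarith
    calc _ ≤ M * (1 + |t|) ^ 4 := h2
      _ ≤ M * ((32 + 8 / c0) * X) := by gcongr
      _ = M * (32 + 8 / c0) * X := by ring
      _ ≤ _ := by apply fin _ 0 _ p3.le (by linarith) hX0 (by linarith)
  · rcases le_or_gt (2 * s) t with hts | hts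
    · refine (key2 ht.le hj).trans ?_
      have : Real.exp (-t ^ 2 / 4) ≤ Real.exp (-s ^ 2) := by
        apply Real.exp_le_exp.2; nlinarith
      calc _ ≤ 8 / c0 * Real.exp (-s ^ 2) := by gcongr
        _ ≤ _ := by apply fin _ 0 _ p1.le (by linarith) hE.le (by linarith)
    · have h1 : gf t ≤ M * (1 + |t|) * ga t := by
        have := (gPhi_lower (-t)).trans (ga_ge t)
        rw [hMM, gf_neg, abs_neg, div_le_iff₀ (by positivity), inv_mul_le_iff₀ hM0] at this
        linarith
      have h2 : gf t / gPhi t ≤ M * (1 + |t|) * ga t / c0 := by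
        have : c0 ≤ gPhi t := gPhi_mono ht.le
        gcongr
      have h3 : 1 + |t| ≤ 3 * s := by rw [abs_of_pos ht]; linarith
      calc _ ≤ (1 + |t|) ^ j * (M * (1 + |t|) * ga t / c0) := by gcongr
        _ = M / c0 * (1 + |t|) ^ (j + 1) * ga t := by ring
        _ ≤ M / c0 * (3 * s) ^ (j + 1) * ga t := by gcongr
        _ = M / c0 * 3 ^ (j + 1) * (s ^ (j + 1) * ga t) := by rw [mul_pow]; ring
        _ ≤ M / c0 * 3 ^ 3 * (s ^ (j + 1) * X) := by
            have : (3:ℝ) ^ (j + 1) ≤ 3 ^ 3 := pow_le_pow_right₀ (by norm_num) (by omega)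
            have : ga t ≤ X := by rw [hX]; nlinarith [sq_nonneg (ga t)]
            gcongr
        _ = 27 * M / c0 * (s ^ (j + 1) * X) := by ring
        _ ≤ _ := by apply fin _ 0 _ p2.le (by linarith) hsX (by linarith)

noncomputable def gD (ε ρ : ℝ) (m : ℕ) : ℝ → ℝ :=
  iteratedDeriv m (fun y => gPhi ((ρ - y) / ε))

lemma gD_contDiff (ε ρ : ℝ) : ContDiff ℝ 3 (fun y => gPhi ((ρ - y) / ε)) := by
  apply gPhi_contDiff.comp
  fun_prop

lemma gf_hasDeriv (t : ℝ) : HasDerivAt gf (-t * gf t) t := by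
  have : gf = fun t : ℝ => (√(2 * π))⁻¹ * Real.exp (-t ^ 2 / 2) := funext gf_eq
  have h1 : HasDerivAt (fun t : ℝ => -t ^ 2 / 2) (-t) t := by
    have := ((hasDerivAt_pow 2 t).neg).div_const 2
    refine this.congr_deriv ?_
    norm_num
    try ring
  have := (h1.exp).const_mul (√(2 * π))⁻¹
  rw [gf_eq t]
  rw [funext gf_eq]
  refine this.congr_deriv ?_
  ring

lemma lin_hasDeriv (ε ρ y : ℝ) : HasDerivAt (fun y => (ρ - y) / ε) (-1 / ε) y := by
  have := ((hasDerivAt_id y).const_sub ρ).div_const ε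
  simpa using this

lemma gD_zero (ε ρ : ℝ) : gD ε ρ 0 = fun y => gPhi ((ρ - y) / ε) := by
  simp [gD, iteratedDeriv_zero]

lemma gD_one (ε ρ : ℝ) : gD ε ρ 1 = fun y => (-1 / ε) * gf ((ρ - y) / ε) := by
  unfold gD
  rw [iteratedDeriv_one]
  funext y
  have := (gPhi_hasDeriv ((ρ - y) / ε)).comp y (lin_hasDeriv ε ρ y)
  rw [mul_comm]
  exact this.deriv

lemma gD_two (ε ρ : ℝ) : gD ε ρ 2 = fun y => (-1 / ε) ^ 2 *
    (-((ρ - y) / ε) * gf ((ρ - y) / ε)) := by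
  have h : gD ε ρ 2 = deriv (gD ε ρ 1) := by unfold gD; rw [iteratedDeriv_succ]
  rw [h, gD_one]
  funext y
  have := ((gf_hasDeriv ((ρ - y) / ε)).comp y (lin_hasDeriv ε ρ y)).const_mul (-1 / ε)
  refine (this.deriv).trans ?_
  ring

lemma gD_three (ε ρ : ℝ) : gD ε ρ 3 = fun y => (-1 / ε) ^ 3 *
    ((((ρ - y) / ε) ^ 2 - 1) * gf ((ρ - y) / ε)) := by
  have h : gD ε ρ 3 = deriv (gD ε ρ 2) := by unfold gD; rw [iteratedDeriv_succ]
  rw [h, gD_two]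
  funext y
  have h1 : HasDerivAt (fun t => -t * gf t) ((((ρ - y) / ε) ^ 2 - 1) * gf ((ρ - y) / ε))
      ((ρ - y) / ε) := by
    have := (hasDerivAt_id ((ρ - y) / ε)).neg.mul (gf_hasDeriv ((ρ - y) / ε))
    refine this.congr_deriv ?_
    norm_num
    try ring
  have := ((h1).comp y (lin_hasDeriv ε ρ y)).const_mul ((-1 / ε) ^ 2)
  refine (this.deriv).trans ?_
  ring

/-- bound for the derivative factors -/
lemma gD_bound {ε : ℝ} (hε : 0 < ε) (ρ y : ℝ) (j : ℕ) (hj : j ≤ 2) :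
    |gD ε ρ (j + 1) y| ≤ (1 / ε) ^ (j + 1) * gPhi ((ρ - y) / ε) *
      ((1 + |(ρ - y) / ε|) ^ j * (gf ((ρ - y) / ε) / gPhi ((ρ - y) / ε))) := by
  set t := (ρ - y) / ε with ht
  have hP := gPhi_pos t
  have hf := gf_pos t
  have e : (1 / ε) ^ (j + 1) * gPhi t * ((1 + |t|) ^ j * (gf t / gPhi t)) =
    (1 / ε) ^ (j + 1) * ((1 + |t|) ^ j * gf t) := by field_simp
  have hab : |(-1 / ε)| = 1 / ε := by rw [abs_div, abs_neg, abs_one, abs_of_pos hε]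
  have h0 := abs_nonneg t
  rw [e]
  have hε1 : 0 < 1 / ε := by positivity
  interval_cases j
  · rw [gD_one]
    simp only [← ht, abs_mul, hab, abs_of_pos hf]
    simp
  · rw [gD_two]
    simp only [← ht, abs_mul, abs_pow, hab, abs_of_pos hf, abs_neg]
    gcongr
    simp
  · rw [gD_three]
    simp only [← ht, abs_mul, abs_pow, hab, abs_of_pos hf]
    gcongr
    rw [abs_le]
    have := sq_abs t
    constructor <;> nlinarith

noncomputable def gPP (p : ℕ) (r : Fin p → ℝ) (ε : ℝ) (m : Fin p → ℕ) (x : Fin p → ℝ) : ℝ :=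
  ∏ k, gD ε (r k) (m k) (x k)

lemma phi_eq (p : ℕ) (r : Fin p → ℝ) {ε : ℝ} (hε : 0 < ε) : phi p r ε = gPP p r ε 0 := by
  funext x
  unfold phi gPP _root_.stdGaussian
  have : {z : Fin p → ℝ | ∀ k, x k + ε * z k ≤ r k} =
      Set.pi Set.univ (fun k => Set.Iic ((r k - x k) / ε)) := by
    ext z
    simp only [Set.mem_setOf_eq, Set.mem_pi, Set.mem_univ, true_imp_iff, Set.mem_Iic]
    refine forall_congr' fun k => ?_
    rw [le_div_iff₀ hε]
    constructor <;> intro h <;> linarith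
  rw [this, Measure.pi_pi, ENNReal.toReal_prod]
  refine Finset.prod_congr rfl fun k _ => ?_
  rw [gaussianReal_apply_eq_integral _ (by simp)]
  simp only [Pi.zero_apply, gD_zero]
  exact ENNReal.toReal_ofReal (gPhi_pos _).le

lemma gD_diff (ε ρ : ℝ) {m : ℕ} (hm : m < 3) : Differentiable ℝ (gD ε ρ m) := by
  unfold gD
  apply (gD_contDiff ε ρ).differentiable_iteratedDeriv
  exact_mod_cast hm

lemma gPP_fderiv (p : ℕ) (r : Fin p → ℝ) (ε : ℝ) (m : Fin p → ℕ) (hm : ∀ k, m k < 3)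
    (a : Fin p) :
    (fun x => fderiv ℝ (gPP p r ε m) x (Pi.single a 1)) = gPP p r ε (m + Pi.single a 1) := by
  funext x
  have h1 : ∀ k ∈ (Finset.univ : Finset (Fin p)), HasFDerivAt (fun x : Fin p → ℝ => gD ε (r k) (m k) (x k))
      (deriv (gD ε (r k) (m k)) (x k) • (ContinuousLinearMap.proj k : (Fin p → ℝ) →L[ℝ] ℝ)) x := by
    intro k _
    exact ((gD_diff ε (r k) (hm k)) (x k)).hasDerivAt.comp_hasFDerivAt x
      (ContinuousLinearMap.proj (R := ℝ) (φ := fun _ : Fin p => ℝ) k).hasFDerivAt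
  have h2 := HasFDerivAt.finsetProd h1
  have h3 : gPP p r ε m = fun x => ∏ k, gD ε (r k) (m k) (x k) := rfl
  rw [h3, h2.fderiv]
  simp only [sum_apply, smul_apply,
    ContinuousLinearMap.proj_apply, smul_eq_mul]
  rw [Finset.sum_eq_single a]
  · unfold gPP
    rw [← Finset.prod_erase_mul _ _ (Finset.mem_univ a)]
    congr 1
    · refine Finset.prod_congr rfl fun k hk => ?_
      simp [Finset.ne_of_mem_erase hk]
    · simp [gD, iteratedDeriv_succ]
  · intro b _ hb
    simp [hb]
  · simp

lemma iter3 {p : ℕ} {f : (Fin p → ℝ) → ℝ} (hf : ContDiff ℝ 3 f) (x u v w : Fin p → ℝ) :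
    iteratedFDeriv ℝ 3 f x ![u, v, w] =
      fderiv ℝ (fun y => fderiv ℝ (fun z => fderiv ℝ f z w) y v) x u := by
  have gen : ∀ (n : ℕ) (_ : n < 3) (y : Fin p → ℝ) (v : Fin p → ℝ) (w : Fin n → Fin p → ℝ),
      iteratedFDeriv ℝ (n + 1) f y (Matrix.vecCons v w) =
      fderiv ℝ (fun z => iteratedFDeriv ℝ n f z w) y v := by
    intro n hn y v w
    have hd : DifferentiableAt ℝ (iteratedFDeriv ℝ n f) y :=
      (hf.differentiable_iteratedFDeriv (by exact_mod_cast hn)) y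
    rw [iteratedFDeriv_succ_apply_left]
    have := (ContinuousMultilinearMap.apply ℝ (fun _ : Fin n => Fin p → ℝ) ℝ w).hasFDerivAt.comp y hd.hasFDerivAt
    have h2 := this.fderiv
    simp only [Function.comp_def, ContinuousMultilinearMap.apply_apply] at h2
    rw [h2]
    simp
  rw [gen 2 (by norm_num)]
  congr 2
  funext y
  rw [gen 1 (by norm_num)]
  congr 2
  funext z
  rw [gen 0 (by norm_num)]
  simp

lemma gPP_contDiff (p : ℕ) (r : Fin p → ℝ) (ε : ℝ) : ContDiff ℝ 3 (gPP p r ε 0) := by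
  unfold gPP
  apply contDiff_prod
  intro k _
  simp only [Pi.zero_apply, gD_zero]
  exact (gD_contDiff ε (r k)).comp (contDiff_apply ℝ ℝ k)

lemma phi_third (p : ℕ) (r : Fin p → ℝ) {ε : ℝ} (hε : 0 < ε) (x : Fin p → ℝ) (a b c : Fin p) :
    iteratedFDeriv ℝ 3 (phi p r ε) x ![Pi.single a 1, Pi.single b 1, Pi.single c 1] =
      gPP p r ε (Pi.single c 1 + Pi.single b 1 + Pi.single a 1) x := by
  have hle : ∀ a k : Fin p, (Pi.single a 1 : Fin p → ℕ) k ≤ 1 := by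
    intro a k
    by_cases h : k = a
    · subst h; simp
    · simp [h]
  rw [phi_eq p r hε, iter3 (gPP_contDiff p r ε), gPP_fderiv _ _ _ _ (by simp),
    gPP_fderiv _ _ _ _ (by intro k; have := hle c k; simp only [Pi.add_apply, Pi.zero_apply]; omega), zero_add]
  have := gPP_fderiv p r ε (Pi.single c 1 + Pi.single b 1) (by
    intro k; have := hle c k; have := hle b k; simp only [Pi.add_apply]; omega) a
  exact congrFun this x

/-- Combinatorial bound for a product with three multiplicities. -/
lemma prod_bound {p : ℕ} (q : ℕ → Fin p → ℝ) (hq : ∀ m k, 0 ≤ q m k) (h0 : ∀ k, q 0 k = 1)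
    (a b c : Fin p) :
    ∏ k, q ((Pi.single c 1 + Pi.single b 1 + Pi.single a 1 : Fin p → ℕ) k) k ≤
      q 1 a * q 1 b * q 1 c + (if a = b then q 2 a * q 1 c else 0)
        + (if b = c then q 2 b * q 1 a else 0) + (if a = c then q 2 a * q 1 b else 0)
        + (if a = b then if a = c then q 3 a else 0 else 0) := by
  have hsub : ∏ k, q ((Pi.single c 1 + Pi.single b 1 + Pi.single a 1 : Fin p → ℕ) k) k =
      ∏ k ∈ ({a, b, c} : Finset (Fin p)),
        q ((Pi.single c 1 + Pi.single b 1 + Pi.single a 1 : Fin p → ℕ) k) k := by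
    symm
    apply Finset.prod_subset (Finset.subset_univ _)
    intro k _ hk
    simp only [Finset.mem_insert, Finset.mem_singleton, not_or] at hk
    simp [hk.1, hk.2.1, hk.2.2, h0]
  rw [hsub]
  have A : ∀ m n k l, 0 ≤ q m k * q n l := fun m n k l => mul_nonneg (hq _ _) (hq _ _)
  have A3 : ∀ k l i, 0 ≤ q 1 k * q 1 l * q 1 i := fun k l i => mul_nonneg (A _ _ _ _) (hq _ _)
  by_cases hab : a = b
  · subst hab
    by_cases hac : a = c
    · subst hac
      simp
      have := A3 a a a; have := A 2 1 a a
      linarith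
    · have hca : c ≠ a := Ne.symm hac
      simp [hac, hca]
      exact A3 _ _ _
  · have hba : b ≠ a := Ne.symm hab
    by_cases hac : a = c
    · subst hac
      simp [hab, hba]
      have := A3 a b a; have := A 2 1 a b
      linarith [mul_comm (q 1 b) (q 2 a)]
    · have hca : c ≠ a := Ne.symm hac
      by_cases hbc : b = c
      · subst hbc
        simp [hab, hba]
        have := A3 a b b
        linarith [mul_comm (q 1 a) (q 2 b)]
      · have hcb : c ≠ b := Ne.symm hbc
        rw [Finset.prod_insert (by simp [hab, hac]), Finset.prod_pair hbc]
        simp [hab, hba, hac, hca, hbc, hcb, mul_assoc]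

lemma sum_bound {p : ℕ} (q : ℕ → Fin p → ℝ) (hq : ∀ m k, 0 ≤ q m k) (h0 : ∀ k, q 0 k = 1) :
    ∑ a, ∑ b, ∑ c, ∏ k, q ((Pi.single c 1 + Pi.single b 1 + Pi.single a 1 : Fin p → ℕ) k) k ≤
      (∑ k, q 1 k) ^ 3 + 3 * ((∑ k, q 2 k) * (∑ k, q 1 k)) + ∑ k, q 3 k := by
  refine (Finset.sum_le_sum fun a _ => Finset.sum_le_sum fun b _ => Finset.sum_le_sum fun c _ =>
    prod_bound q hq h0 a b c).trans (le_of_eq ?_)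
  simp only [Finset.sum_add_distrib]
  have e1 : ∑ a, ∑ b, ∑ c, q 1 a * q 1 b * q 1 c = (∑ k, q 1 k) ^ 3 := by
    simp only [← Finset.mul_sum, ← Finset.sum_mul]; ring
  have e2 : ∑ a, ∑ b, ∑ c, (if a = b then q 2 a * q 1 c else 0) = (∑ k, q 2 k) * (∑ k, q 1 k) := by
    rw [Finset.sum_mul_sum]
    refine Finset.sum_congr rfl fun a _ => ?_
    rw [Finset.sum_comm]; simp
  have e3 : ∑ a, ∑ b, ∑ c, (if b = c then q 2 b * q 1 a else 0) = (∑ k, q 2 k) * (∑ k, q 1 k) := by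
    rw [Finset.sum_mul_sum, Finset.sum_comm]; simp
  have e4 : ∑ a, ∑ b, ∑ c, (if a = c then q 2 a * q 1 b else 0) = (∑ k, q 2 k) * (∑ k, q 1 k) := by
    rw [Finset.sum_mul_sum]; simp
  have e5 : ∑ a, ∑ b, ∑ c, (if a = b then if a = c then q 3 a else 0 else 0) = ∑ k, q 3 k := by
    refine Finset.sum_congr rfl fun a _ => ?_
    rw [Finset.sum_comm]; simp
  rw [e1, e2, e3, e4, e5]; ring

noncomputable def gq {p : ℕ} (t : Fin p → ℝ) : ℕ → Fin p → ℝ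
  | 0, _ => 1
  | (j + 1), k => (1 + |t k|) ^ j * (gf (t k) / gPhi (t k))

lemma gq_nonneg {p : ℕ} (t : Fin p → ℝ) (m : ℕ) (k : Fin p) : 0 ≤ gq t m k := by
  cases m with
  | zero => simp [gq]
  | succ j =>
    have := gf_pos (t k); have := gPhi_pos (t k)
    simp only [gq]; positivity

lemma total_bound (p : ℕ) (r : Fin p → ℝ) {ε : ℝ} (hε : 0 < ε) (x t : Fin p → ℝ)
    (ht : ∀ k, t k = (r k - x k) / ε) :
    ∑ a : Fin p, ∑ b : Fin p, ∑ k : Fin p,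
      |iteratedFDeriv ℝ 3 (phi p r ε) x ![Pi.single a 1, Pi.single b 1, Pi.single k 1]| ≤
    (1 / ε) ^ 3 * Real.exp (-∑ k, ga (t k)) *
      ((∑ k, gq t 1 k) ^ 3 + 3 * ((∑ k, gq t 2 k) * (∑ k, gq t 1 k)) + ∑ k, gq t 3 k) := by
  have hF : Real.exp (-∑ k, ga (t k)) = ∏ k, gPhi (t k) := by
    rw [← Finset.sum_neg_distrib, Real.exp_sum]
    exact Finset.prod_congr rfl fun k _ => exp_ga _
  refine le_trans ?_ (mul_le_mul_of_nonneg_left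
    (sum_bound (gq t) (gq_nonneg t) (fun k => rfl)) (by positivity))
  simp only [Finset.mul_sum]
  refine Finset.sum_le_sum fun a _ => Finset.sum_le_sum fun b _ => Finset.sum_le_sum fun c _ => ?_
  rw [phi_third p r hε]
  set m : Fin p → ℕ := Pi.single c 1 + Pi.single b 1 + Pi.single a 1 with hm
  have hle : ∀ a k : Fin p, (Pi.single a 1 : Fin p → ℕ) k ≤ 1 := by
    intro a k
    by_cases h : k = a
    · subst h; simp
    · simp [h]
  have hmk : ∀ k, m k ≤ 3 := by
    intro k; have := hle a k; have := hle b k; have := hle c k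
    simp only [hm, Pi.add_apply]; omega
  have hsum : ∑ k, m k = 3 := by
    simp [hm, Finset.sum_add_distrib]
  unfold gPP
  rw [Finset.abs_prod, hF, ← hsum, ← Finset.prod_pow_eq_pow_sum, ← Finset.prod_mul_distrib,
    ← Finset.prod_mul_distrib]
  refine Finset.prod_le_prod (fun k _ => abs_nonneg _) fun k _ => ?_
  have hk := hmk k
  rw [ht k]
  rcases hmc : m k with _ | j
  · simp only [gD_zero, gq]
    rw [abs_of_pos (gPhi_pos _)]; simp
  · have := gD_bound hε (r k) (x k) j (by omega)
    simp only [gq, ht k]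
    exact this

lemma poly_exp {A : ℝ} (hA : 0 ≤ A) :
    Real.exp (-A) * (1 + (A + A ^ 2)) ^ 3 ≤ 12 ^ 6 * Real.exp (-A / 2) := by
  have h1 : 1 + A ≤ 12 * Real.exp (A / 12) := by
    have := Real.add_one_le_exp (A / 12); linarith
  have h2 : 1 + (A + A ^ 2) ≤ (1 + A) ^ 2 := by nlinarith
  have h3 : (1 + (A + A ^ 2)) ^ 3 ≤ 12 ^ 6 * Real.exp (A / 2) := by
    calc (1 + (A + A ^ 2)) ^ 3 ≤ ((1 + A) ^ 2) ^ 3 := by gcongr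
      _ = (1 + A) ^ 6 := by ring
      _ ≤ (12 * Real.exp (A / 12)) ^ 6 := by gcongr
      _ = 12 ^ 6 * Real.exp (A / 2) := by
        rw [mul_pow, ← Real.exp_nat_mul]; congr 2; push_cast; ring
  calc _ ≤ Real.exp (-A) * (12 ^ 6 * Real.exp (A / 2)) := by gcongr
    _ = 12 ^ 6 * (Real.exp (-A) * Real.exp (A / 2)) := by ring
    _ = _ := by rw [← Real.exp_add]; ring_nf

lemma cubic_bound {S1 S2 S3 K s B : ℝ} (h1 : 0 ≤ S1) (h2 : 0 ≤ S2) (hK : 1 ≤ K)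
    (hs : 0 ≤ s) (hB : 1 ≤ B) (e1 : S1 ≤ K * (s ^ 1 * B)) (e2 : S2 ≤ K * (s ^ 2 * B))
    (e3 : S3 ≤ K * (s ^ 3 * B)) :
    S1 ^ 3 + 3 * (S2 * S1) + S3 ≤ 5 * K ^ 3 * (s ^ 3 * B ^ 3) := by
  have hK0 : 0 ≤ K := by linarith
  have hB0 : 0 ≤ B := by linarith
  have a1 : S1 ^ 3 ≤ K ^ 3 * (s ^ 3 * B ^ 3) := by
    calc S1 ^ 3 ≤ (K * (s ^ 1 * B)) ^ 3 := by gcongr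
      _ = _ := by ring
  have a2 : S2 * S1 ≤ K ^ 3 * (s ^ 3 * B ^ 3) := by
    calc S2 * S1 ≤ (K * (s ^ 2 * B)) * (K * (s ^ 1 * B)) := by gcongr
      _ = K ^ 2 * (s ^ 3 * B ^ 2) := by ring
      _ ≤ _ := by gcongr <;> first | assumption | norm_num
  have a3 : S3 ≤ K ^ 3 * (s ^ 3 * B ^ 3) := by
    refine e3.trans ?_
    have : K ≤ K ^ 3 := le_self_pow₀ hK (by norm_num)
    have : B ≤ B ^ 3 := le_self_pow₀ hB (by norm_num)
    gcongr
  linarith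

set_option maxHeartbeats 1000000

theorem stmt18 :
    ∃ c C : ℝ, 0 < c ∧ 0 < C ∧
      ∀ (p n : ℕ), 0 < p → 0 < n →
      ∀ (r : Fin p → ℝ) (ε : ℝ), 0 < ε →
        ∀ x : Fin p → ℝ,
          ∑ a : Fin p, ∑ b : Fin p, ∑ k : Fin p,
              |iteratedFDeriv ℝ 3 (phi p r ε) x
                ![Pi.single a 1, Pi.single b 1, Pi.single k 1]| ≤
            C * (1 / (ε ^ 3 * p * n)
              + Real.log (Real.exp 1 * p) ^ ((3 : ℝ) / 2) / ε ^ 3 *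
                (if x ∈ slab r (c * ε * Real.sqrt (Real.log ((p : ℝ) * n))) then 1 else 0)) := by
  obtain ⟨K, hK, hkey⟩ := key1
  set K2 := 1 + 8 / gPhi 0 with hK2
  have hK2' : 1 ≤ K2 := by have := gPhi_pos 0; rw [hK2]; linarith [show 0 < 8 / gPhi 0 by positivity]
  have hK0 : 0 < K := by linarith
  have hK20 : 0 < K2 := by linarith
  set C := 5 * K ^ 3 * 12 ^ 6 + 5 * K2 ^ 3 with hC
  have hC0 : 0 < C := by positivity
  refine ⟨4, C, by norm_num, hC0, ?_⟩
  intro p n hp hn r ε hε x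
  set N : ℝ := (p : ℝ) * n with hN
  have hp1 : (1 : ℝ) ≤ p := by exact_mod_cast hp
  have hn1 : (1 : ℝ) ≤ n := by exact_mod_cast hn
  have hN1 : 1 ≤ N := by rw [hN]; nlinarith
  have hN0 : 0 < N := by linarith
  have hpN : (p : ℝ) ≤ N := by rw [hN]; nlinarith
  have hlogN : 0 ≤ Real.log N := Real.log_nonneg hN1
  set L := Real.log (Real.exp 1 * p) with hL
  have hLeq : L = 1 + Real.log p := by
    rw [hL, Real.log_mul (Real.exp_pos 1).ne' (by positivity), Real.log_exp]
  have hL1 : 1 ≤ L := by linarith [Real.log_nonneg hp1]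
  have hLp : L ≤ p := by
    have := Real.log_le_sub_one_of_pos (show (0:ℝ) < p by linarith); linarith
  set s := √L with hs
  have hs1 : 1 ≤ s := by rw [hs, Real.one_le_sqrt]; exact hL1
  have hsq : s ^ 2 = L := Real.sq_sqrt (by linarith)
  have hL32 : L ^ ((3 : ℝ) / 2) = s ^ 3 := by
    rw [← hsq, ← Real.rpow_natCast s 2, ← Real.rpow_mul (by linarith), ← Real.rpow_natCast s 3]
    norm_num
  rw [hL32]
  set τ := √(Real.log N) with hτ
  have hτ2 : τ ^ 2 = Real.log N := Real.sq_sqrt hlogN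
  have hτ0 : 0 ≤ τ := Real.sqrt_nonneg _
  set t : Fin p → ℝ := fun k => (r k - x k) / ε with ht
  have htot := total_bound p r hε x t (fun k => rfl)
  set A := ∑ k, ga (t k) with hA
  have hA0 : 0 ≤ A := Finset.sum_nonneg fun k _ => ga_nonneg _
  have hS : ∀ m, 0 ≤ ∑ k, gq t m k := fun m => Finset.sum_nonneg fun k _ => gq_nonneg t m k
  have hexpm : ∀ m : ℕ, Real.exp (-(m * Real.log N)) = 1 / N ^ m := by
    intro m
    rw [Real.exp_neg, Real.exp_nat_mul, Real.exp_log hN0, one_div]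
  -- general bound
  have hgen : Real.exp (-A) * ((∑ k, gq t 1 k) ^ 3 + 3 * ((∑ k, gq t 2 k) * (∑ k, gq t 1 k))
      + ∑ k, gq t 3 k) ≤ 5 * K ^ 3 * 12 ^ 6 * (s ^ 3 * Real.exp (-A / 2)) := by
    have hj : ∀ j : ℕ, j ≤ 2 → ∑ k, gq t (j + 1) k ≤ K * (s ^ (j + 1) * (1 + (A + A ^ 2))) := by
      intro j hj
      have hsq2 : ∑ k, ga (t k) ^ 2 ≤ A ^ 2 :=
        Finset.sum_sq_le_sq_sum_of_nonneg fun k _ => ga_nonneg _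
      have hexp : Real.exp (-s ^ 2) * p ≤ 1 := by
        rw [hsq, hL, Real.exp_neg, Real.exp_log (by positivity), mul_inv]
        rw [mul_assoc, inv_mul_cancel₀ (by positivity), mul_one]
        exact inv_le_one_of_one_le₀ (Real.one_le_exp (by norm_num))
      have hsj : 1 ≤ s ^ (j + 1) := one_le_pow₀ hs1
      calc ∑ k, gq t (j + 1) k ≤
          ∑ k, K * (Real.exp (-s ^ 2) + s ^ (j + 1) * (ga (t k) + ga (t k) ^ 2)) :=
            Finset.sum_le_sum fun k _ => hkey s (t k) j hs1 hj
        _ = K * (Real.exp (-s ^ 2) * p + s ^ (j + 1) * (A + ∑ k, ga (t k) ^ 2)) := by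
            rw [← Finset.mul_sum, Finset.sum_add_distrib, ← Finset.mul_sum,
              Finset.sum_add_distrib]
            simp [mul_comm, hA]
        _ ≤ K * (s ^ (j + 1) + s ^ (j + 1) * (A + A ^ 2)) := by
            gcongr
            linarith
        _ = _ := by ring
    have := cubic_bound (hS 1) (hS 2) hK (by linarith) (by nlinarith : 1 ≤ 1 + (A + A ^ 2))
      (hj 0 (by norm_num)) (hj 1 (by norm_num)) (hj 2 (by norm_num))
    calc _ ≤ Real.exp (-A) * (5 * K ^ 3 * (s ^ 3 * (1 + (A + A ^ 2)) ^ 3)) := by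
          exact mul_le_mul_of_nonneg_left this (Real.exp_pos _).le
      _ = 5 * K ^ 3 * s ^ 3 * (Real.exp (-A) * (1 + (A + A ^ 2)) ^ 3) := by ring
      _ ≤ 5 * K ^ 3 * s ^ 3 * (12 ^ 6 * Real.exp (-A / 2)) := by
          exact mul_le_mul_of_nonneg_left (poly_exp hA0) (by positivity)
      _ = _ := by ring
  refine htot.trans ?_
  have hfac : C * (1 / (ε ^ 3 * p * n) + s ^ 3 / ε ^ 3 *
      (if x ∈ slab r (4 * ε * τ) then 1 else 0)) = (1 / ε) ^ 3 * (C * (1 / N + s ^ 3 *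
      (if x ∈ slab r (4 * ε * τ) then 1 else 0))) := by
    rw [hN]
    field_simp
  rw [hfac, mul_assoc]
  refine mul_le_mul_of_nonneg_left ?_ (by positivity)
  have hs3 : s ^ 3 ≤ N ^ 2 := by
    calc s ^ 3 ≤ s ^ 4 := pow_le_pow_right₀ hs1 (by norm_num)
      _ = L ^ 2 := by rw [← hsq]; ring
      _ ≤ N ^ 2 := by gcongr; linarith
  by_cases hx : x ∈ slab r (4 * ε * τ)
  · rw [if_pos hx]
    refine hgen.trans ?_
    have h1 : Real.exp (-A / 2) ≤ 1 := Real.exp_le_one_iff.2 (by linarith)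
    have h2 : 0 ≤ 1 / N := by positivity
    calc _ ≤ 5 * K ^ 3 * 12 ^ 6 * (s ^ 3 * 1) := by gcongr
      _ ≤ C * (1 / N + s ^ 3 * 1) := by
        have : 5 * K ^ 3 * 12 ^ 6 ≤ C := by rw [hC]; linarith [show 0 < 5 * K2 ^ 3 by positivity]
        gcongr
        linarith
  · rw [if_neg hx, mul_zero, add_zero]
    have hx' : (∃ k, r k + 4 * ε * τ < x k) ∨ ∀ k, x k ≤ r k - 4 * ε * τ := by
      by_contra hcon
      push Not at hcon
      exact hx ⟨hcon.1, fun h => by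
        obtain ⟨k, hk⟩ := hcon.2
        exact absurd (h k) (not_le.2 hk)⟩
    rcases hx' with ⟨k, hk⟩ | hall
    · refine hgen.trans ?_
      have htk : t k ≤ -(4 * τ) := by
        simp only [ht]
        rw [div_le_iff₀ hε]; nlinarith
      have h1 : 8 * Real.log N ≤ A := by
        have h2 : ga (t k) ≤ A :=
          Finset.single_le_sum (f := fun k => ga (t k)) (fun k _ => ga_nonneg _) (Finset.mem_univ k)
        have h3 := ga_ge_sq (t := t k) (by linarith)
        have h5 : (4 * τ) ^ 2 ≤ t k ^ 2 := by
          rw [← neg_sq (t k)]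
          exact pow_le_pow_left₀ (by linarith) (by linarith) 2
        have h6 : (4 * τ) ^ 2 = 16 * Real.log N := by rw [← hτ2]; ring
        linarith
      have h4 : Real.exp (-A / 2) ≤ 1 / N ^ 4 := by
        rw [← hexpm 4]; apply Real.exp_le_exp.2; push_cast; linarith
      calc _ ≤ 5 * K ^ 3 * 12 ^ 6 * (N ^ 2 * (1 / N ^ 4)) := by gcongr
        _ = 5 * K ^ 3 * 12 ^ 6 * (1 / N ^ 2) := by field_simp
        _ ≤ C * (1 / N) := by
          have : 5 * K ^ 3 * 12 ^ 6 ≤ C := by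
            rw [hC]; linarith [show 0 < 5 * K2 ^ 3 by positivity]
          have : N ≤ N ^ 2 := le_self_pow₀ hN1 (by norm_num)
          gcongr
    · have htk : ∀ k, 4 * τ ≤ t k := by
        intro k
        have := hall k
        simp only [ht]
        rw [le_div_iff₀ hε]; nlinarith
      have hj : ∀ j : ℕ, j ≤ 2 → ∑ k, gq t (j + 1) k ≤ K2 * (1 / N) := by
        intro j hj
        have h1 : ∀ k, gq t (j + 1) k ≤ K2 * (1 / N ^ 4) := by
          intro k
          refine (key2 (t := t k) (by linarith [htk k]) hj).trans ?_
          have : Real.exp (-t k ^ 2 / 4) ≤ 1 / N ^ 4 := by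
            rw [← hexpm 4]; apply Real.exp_le_exp.2; push_cast
            nlinarith [htk k]
          have h8 : 8 / gPhi 0 ≤ K2 := by rw [hK2]; linarith
          gcongr
        calc _ ≤ ∑ _k : Fin p, K2 * (1 / N ^ 4) := Finset.sum_le_sum fun k _ => h1 k
          _ = p * (K2 * (1 / N ^ 4)) := by simp
          _ ≤ N * (K2 * (1 / N ^ 4)) := by gcongr
          _ = K2 * (1 / N ^ 3) := by field_simp
          _ ≤ _ := by
            have : N ≤ N ^ 3 := le_self_pow₀ hN1 (by norm_num)
            gcongr
      have hy0 : 0 < 1 / N := by positivity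
      have hy1 : 1 / N ≤ 1 := by rw [div_le_one hN0]; exact hN1
      have b1 := hj 0 (by norm_num)
      have b2 := hj 1 (by norm_num)
      have b3 := hj 2 (by norm_num)
      norm_num only at b1 b2 b3
      have hE : Real.exp (-A) ≤ 1 := Real.exp_le_one_iff.2 (by linarith)
      have d1 : (∑ k, gq t 1 k) ^ 3 ≤ K2 ^ 3 * (1 / N) := by
        calc _ ≤ (K2 * (1 / N)) ^ 3 := pow_le_pow_left₀ (hS 1) b1 3
          _ = K2 ^ 3 * (1 / N) ^ 3 := by ring
          _ ≤ _ := by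
            gcongr
            exact pow_le_of_le_one hy0.le hy1 (by norm_num)
      have d2 : (∑ k, gq t 2 k) * (∑ k, gq t 1 k) ≤ K2 ^ 3 * (1 / N) := by
        calc _ ≤ (K2 * (1 / N)) * (K2 * (1 / N)) := mul_le_mul b2 b1 (hS 1) (by positivity)
          _ = K2 ^ 2 * (1 / N) ^ 2 := by ring
          _ ≤ _ := by
            have := pow_le_of_le_one hy0.le hy1 (two_ne_zero)
            have : K2 ^ 2 ≤ K2 ^ 3 := pow_le_pow_right₀ hK2' (by norm_num)
            gcongr
      have d3 : ∑ k, gq t 3 k ≤ K2 ^ 3 * (1 / N) := by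
        refine b3.trans ?_
        have : K2 ≤ K2 ^ 3 := le_self_pow₀ hK2' (by norm_num)
        gcongr
      have hnn : 0 ≤ (∑ k, gq t 1 k) ^ 3 + 3 * ((∑ k, gq t 2 k) * (∑ k, gq t 1 k))
          + ∑ k, gq t 3 k := by
        have := hS 1; have := hS 2; have := hS 3; positivity
      calc _ ≤ (∑ k, gq t 1 k) ^ 3 + 3 * ((∑ k, gq t 2 k) * (∑ k, gq t 1 k))
          + ∑ k, gq t 3 k := mul_le_of_le_one_left hnn hE
        _ ≤ 5 * K2 ^ 3 * (1 / N) := by linarith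
        _ ≤ C * (1 / N) := by
          gcongr
          rw [hC]; linarith [show 0 < 5 * K ^ 3 * 12 ^ 6 by positivity]
end
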